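/- arXiv:2401.11930 — 2 statements merged into one kernel-verified Lean document; each statement's English description precedes it below -/
import Mathlib

section
/- Let C be a field of imperfect exponent at most 1. If (F,v) and (F′,v′) are henselian nontrivially valued fields which are separable extensions of the trivially valued field C, such that the residue fields Fv and F′v′ have the same universal/existential 𝔏_ring(C)-theory and every geometrically integral smooth affine C-variety has a rational point over both Fv and F′v′, then the fields F and F′ have the same universal/existential 𝔏_ring(C)-theory. -/
open FirstOrder Language

/-- The language with a single unary relation symbol `𝒪`. -/
def LO : Language :=
  ⟨fun _ => Empty, fun n => match n with | 1 => PUnit | _ => Empty⟩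

/-- The one-sorted language of valued fields `𝔏_val = 𝔏_ring ∪ {𝒪}`. -/
def Lval : Language := Language.ring.sum LO

/-- The `LO`-structure on a type given by a subset interpreting `𝒪`. -/
def LOStructure {F : Type*} (O : Set F) : LO.Structure F where
  funMap := fun f _ => f.elim
  RelMap := fun {n} r x =>
    match n, r, x with
    | 1, _, x => x 0 ∈ O

/-- The canonical `ring`-structure on a field. -/
noncomputable def ringStructure (F : Type*) [Field F] : Language.ring.Structure F :=
  (Ring.compatibleRingOfRing F).toStructure

/-- The `Lval`-structure of a valued field, `𝒪` interpreted as the valuation ring. -/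
noncomputable def valStructure (F : Type*) [Field F] (O : ValuationSubring F) :
    Lval.Structure F :=
  letI := ringStructure F
  letI := LOStructure (O : Set F)
  Language.sumStructure _ _ F

/-- The `Lval[[C]]`-structure of a valued field with constants interpreted via `ι`. -/
noncomputable def valCStructure (C : Type*) (F : Type*) [Field F] (ι : C → F)
    (O : ValuationSubring F) : (Lval[[C]]).Structure F :=
  letI := valStructure F O
  letI := constantsOn.structure ι
  Language.sumStructure _ _ F

/-- The `ring[[C]]`-structure on a field with constants interpreted via `ι`. -/
noncomputable def ringCStructure (C : Type*) (F : Type*) [Field F] (ι : C → F) :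
    (Language.ring[[C]]).Structure F :=
  letI := ringStructure F
  letI := constantsOn.structure ι
  Language.sumStructure _ _ F

/-- Satisfaction of an `𝔏_val`-sentence in a valued field. -/
def SatV {F : Type*} [Field F] (O : ValuationSubring F) (φ : Lval.Sentence) : Prop :=
  letI := valStructure F O
  F ⊨ φ

/-- Satisfaction of an `𝔏_val(C)`-sentence in a valued field with constants `ι`. -/
def SatVC (C : Type*) {F : Type*} [Field F] (ι : C → F) (O : ValuationSubring F)
    (φ : (Lval[[C]]).Sentence) : Prop :=
  letI := valCStructure C F ι O
  F ⊨ φ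

/-- Satisfaction of an `𝔏_ring`-sentence in a field. -/
def SatR (F : Type*) [Field F] (φ : Language.ring.Sentence) : Prop :=
  letI := ringStructure F
  F ⊨ φ

/-- Satisfaction of an `𝔏_ring(C)`-sentence in a field with constants `ι`. -/
def SatRC (C : Type*) (F : Type*) [Field F] (ι : C → F)
    (φ : (Language.ring[[C]]).Sentence) : Prop :=
  letI := ringCStructure C F ι
  F ⊨ φ

/-- An existential sentence: a quantifier-free formula with all variables
existentially quantified. -/
def IsExistentialSen {L : Language} (φ : L.Sentence) : Prop :=
  ∃ (n : ℕ) (ψ : L.BoundedFormula Empty n), ψ.IsQF ∧ φ = ψ.exs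

/-- A universal sentence. -/
def IsUniversalSen {L : Language} (φ : L.Sentence) : Prop :=
  ∃ (n : ℕ) (ψ : L.BoundedFormula Empty n), ψ.IsQF ∧ φ = ψ.alls

/-- A universal/existential sentence: a finite conjunction/disjunction combination of
existential and universal sentences. -/
inductive IsUE {L : Language} : L.Sentence → Prop
  | ex {φ} : IsExistentialSen φ → IsUE φ
  | all {φ} : IsUniversalSen φ → IsUE φ
  | inf {φ ψ} : IsUE φ → IsUE ψ → IsUE (φ ⊓ ψ)
  | sup {φ ψ} : IsUE φ → IsUE ψ → IsUE (φ ⊔ ψ)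
/-- A place of a function field `K` over `k` (given by `ι : k →+* K`): a nontrivial
valuation subring of `K` containing (the image of) `k`. -/
def IsPlace {k K : Type*} [Field k] [Field K] (ι : k →+* K) (O : ValuationSubring K) : Prop :=
  O ≠ ⊤ ∧ ∀ c, ι c ∈ O

/-- `K/k` is a function field of one variable: finitely generated of transcendence
degree 1 (equivalently, finite over `k(t)` for some transcendental `t`), with `k`
relatively algebraically closed in `K`. -/
structure IsFunctionField (k K : Type*) [Field k] [Field K] [Algebra k K] : Prop where
  exists_primitive : ∃ t : K, Transcendental k t ∧
    FiniteDimensional ↥(IntermediateField.adjoin k {t}) K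
  constants_closed : ∀ x : K, IsAlgebraic k x → ∃ c : k, algebraMap k K c = x

section Completion

variable (K : Type*) [Field K] (v : ValuationSubring K)

/-- The completion `K̂_v` of the valued field `(K, v)`. -/
noncomputable def Cmpl : Type _ :=
  letI := Valued.mk' v.valuation
  UniformSpace.Completion K

noncomputable instance : Field (Cmpl K v) :=
  letI := Valued.mk' v.valuation
  UniformSpace.Completion.instField

/-- The valuation ring of the canonical extension of `v` to the completion `K̂_v`. -/
noncomputable def cmplO : ValuationSubring (Cmpl K v) := by
  letI := Valued.mk' v.valuation
  letI : Field (UniformSpace.Completion K) := UniformSpace.Completion.instField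
  letI : Valued (UniformSpace.Completion K) v.ValueGroup := Valued.valuedCompletion
  exact (Valued.v : Valuation (UniformSpace.Completion K) v.ValueGroup).valuationSubring

/-- The canonical embedding of `K` into its completion `K̂_v`. -/
noncomputable def cmplEmb : K →+* Cmpl K v := by
  letI := Valued.mk' v.valuation
  letI : Field (UniformSpace.Completion K) := UniformSpace.Completion.instField
  exact UniformSpace.Completion.coeRingHom

end Completion

section Residue

variable {F : Type*} [Field F] (O : ValuationSubring F)

/-- The residue field `Fv` of a valued field. -/
noncomputable abbrev ResF := IsLocalRing.ResidueField ↥O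

/-- The interpretation of constants from `C` in the residue field, via the residue map. -/
noncomputable def resConst {C : Type*} (ι : C → F) (h : ∀ c, ι c ∈ O) :
    C → ResF O :=
  fun c => IsLocalRing.residue _ ⟨ι c, h c⟩

/-- The interpretation of constants from `C` in the residue field, via the residue map,
extended by `0` outside the valuation ring. -/
noncomputable def resConstExt {C : Type*} (ι : C → F) : C → ResF O :=
  open scoped Classical in
  fun c => if h : ι c ∈ O then IsLocalRing.residue _ ⟨ι c, h⟩ else 0

end Residue

/-- A field is pseudofinite if it is infinite and models the first-order theory of
the class of all finite fields. -/
def IsPseudofinite (F : Type*) [Field F] : Prop :=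
  Infinite F ∧ ∀ φ : Language.ring.Sentence,
    (∀ (E : Type) (_ : Field E) (_ : Finite E), SatR E φ) → SatR F φ
/-- The residue ring homomorphism `C →+* Fv` of a valued field extending the trivially
valued field `C`. -/
noncomputable def resRingHom {F : Type*} [Field F] (O : ValuationSubring F) {C : Type*}
    [Field C] (ι : C →+* F) (h : ∀ c, ι c ∈ O) : C →+* ResF O :=
  (IsLocalRing.residue ↥O).comp (ι.codRestrict O h)

/-- `C` has imperfect exponent at most `1`, i.e. `[C : Cᵖ] ≤ p` in characteristic `p`
(no condition in characteristic `0`). -/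
def ImperfectExpLEOne (C : Type*) [Field C] : Prop :=
  ∀ p : ℕ, p.Prime → ringChar C = p →
    Module.rank ↥(Subfield.closure {x : C | ∃ y : C, y ^ p = x}) C ≤ p

/-- The field extension `F/C` (along `ι`) is separable: its base change to every field
extension of `C` is reduced. -/
def SeparableExt {C F : Type*} [Field C] [Field F] (ι : C →+* F) : Prop :=
  ∀ (E : Type) (_ : Field E) (j : C →+* E),
    letI := ι.toAlgebra
    letI := j.toAlgebra
    IsReduced (TensorProduct C F E)

open TensorProduct

/-- Over an algebraically closed field, the tensor product of a domain of finite type with any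
domain is a domain. -/
theorem isDomain_tensorProduct_of_isAlgClosed (k A B : Type*) [Field k] [IsAlgClosed k]
    [CommRing A] [Algebra k A] [CommRing B] [Algebra k B] [Algebra.FiniteType k A]
    [IsDomain A] [IsDomain B] : IsDomain (A ⊗[k] B) := by
  let b := Module.Free.chooseBasis k B
  let bA := b.baseChange A
  have hnt : Nontrivial (A ⊗[k] B) := inferInstance
  -- reduction modulo a maximal ideal
  have hA : IsJacobsonRing A := isJacobsonRing_of_finiteType (A := k)
  have key : ∀ x y : A ⊗[k] B, x * y = 0 → ∀ m : Ideal A, m.IsMaximal →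
      (∀ i, bA.repr x i ∈ m) ∨ (∀ i, bA.repr y i ∈ m) := by
    intro x y hxy m hm
    have : Algebra.FiniteType k (A ⧸ m) := inferInstance
    let := Ideal.Quotient.field m
    have : Module.Finite k (A ⧸ m) := finite_of_finite_type_of_isJacobsonRing k (A ⧸ m)
    have hbij : Function.Bijective (algebraMap k (A ⧸ m)) :=
      IsAlgClosed.algebraMap_bijective_of_isIntegral
    let e : k ≃ₐ[k] (A ⧸ m) := AlgEquiv.ofBijective (Algebra.ofId k _) hbij
    let χ : A →ₐ[k] k := e.symm.toAlgHom.comp (Ideal.Quotient.mkₐ k m)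
    have hχ : ∀ a, χ a = 0 ↔ a ∈ m := by
      intro a
      simp [χ, Ideal.Quotient.eq_zero_iff_mem]
    let Φ : A ⊗[k] B →ₐ[k] B :=
      (Algebra.TensorProduct.lid k B).toAlgHom.comp (Algebra.TensorProduct.map χ (.id k B))
    have hΦ : ∀ (z : A ⊗[k] B) i, b.repr (Φ z) i = χ (bA.repr z i) := by
      intro z i
      induction z with
      | zero => simp
      | add u v hu hv => simp [hu, hv]
      | tmul a c => simp [Φ, bA, mul_comm]
    have h0 : Φ x * Φ y = 0 := by rw [← map_mul, hxy, map_zero]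
    rcases mul_eq_zero.mp h0 with h | h
    · left; intro i; rw [← hχ, ← hΦ, h]; simp
    · right; intro i; rw [← hχ, ← hΦ, h]; simp
  have hnzd : NoZeroDivisors (A ⊗[k] B) := by
    refine ⟨fun {x y} hxy => ?_⟩
    by_contra! hne
    obtain ⟨i, hi⟩ : ∃ i, bA.repr x i ≠ 0 := by
      by_contra! h; exact hne.1 (bA.repr.injective (by ext i; simp [h]))
    obtain ⟨j, hj⟩ : ∃ i, bA.repr y i ≠ 0 := by
      by_contra! h; exact hne.2 (bA.repr.injective (by ext i; simp [h]))
    have hmem : bA.repr x i * bA.repr y j ∈ (⊥ : Ideal A).jacobson := by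
      rw [Ideal.jacobson, Ideal.mem_sInf]
      rintro m ⟨-, hm⟩
      rcases key x y hxy m hm with h | h
      · exact m.mul_mem_right _ (h i)
      · exact m.mul_mem_left _ (h j)
    rw [hA.out Ideal.isRadical_bot, Ideal.mem_bot] at hmem
    exact mul_ne_zero hi hj hmem
  exact NoZeroDivisors.to_isDomain _

/-- Over an algebraically closed field, a finite family of domains of finite type has a coproduct
that is again a domain. -/
theorem exists_isDomain_coproduct (k : Type) [Field k] [IsAlgClosed k] (ι : Type) [Finite ι]
    (A : ι → Type) [∀ σ, CommRing (A σ)] [∀ σ, Algebra k (A σ)]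
    [∀ σ, Algebra.FiniteType k (A σ)] [∀ σ, IsDomain (A σ)] :
    ∃ (D : Type) (_ : CommRing D) (_ : Algebra k D) (i : ∀ σ, A σ →ₐ[k] D), IsDomain D ∧
      ∀ (S : Type) [CommRing S] [Algebra k S] (g : ∀ σ, A σ →ₐ[k] S),
        ∃ φ : D →ₐ[k] S, ∀ σ, φ.comp (i σ) = g σ := by
  induction ι using Finite.induction_empty_option with
  | @of_equiv α β e ih =>
    obtain ⟨D, _, _, i, hD, hi⟩ := ih (fun a => A (e a))
    have hr : ∀ (S : Type) [CommRing S] [Algebra k S] (f : ∀ σ, A (e σ) →ₐ[k] S),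
        ∃ g : ∀ σ, A σ →ₐ[k] S, ∀ a, g (e a) = f a := by
      intro S _ _ f
      refine ⟨(e.piCongrLeft (fun σ => A σ →ₐ[k] S)) f, fun a => ?_⟩
      exact Equiv.piCongrLeft_apply_apply (fun σ => A σ →ₐ[k] S) e f a
    obtain ⟨j, hj⟩ := hr D i
    refine ⟨D, _, _, j, hD, fun S _ _ g => ?_⟩
    obtain ⟨φ, hφ⟩ := hi S (fun a => g (e a))
    refine ⟨φ, fun σ => ?_⟩
    obtain ⟨a, rfl⟩ := e.surjective σ
    rw [hj, hφ]
  | h_empty =>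
    exact ⟨k, _, _, fun σ => σ.elim, inferInstance,
      fun S _ _ g => ⟨Algebra.ofId k S, fun σ => σ.elim⟩⟩
  | @h_option α _ ih =>
    obtain ⟨D, _, _, i, hD, hi⟩ := ih (fun a => A (some a))
    refine ⟨A none ⊗[k] D, inferInstance, inferInstance,
      fun σ => match σ with
        | none => Algebra.TensorProduct.includeLeft
        | some a => Algebra.TensorProduct.includeRight.comp (i a),
      isDomain_tensorProduct_of_isAlgClosed k _ _, fun S _ _ g => ?_⟩
    obtain ⟨φ, hφ⟩ := hi S (fun a => g (some a))
    refine ⟨Algebra.TensorProduct.productMap (g none) φ, fun σ => ?_⟩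
    match σ with
    | none => ext x; simp
    | some a => ext x; simp [← hφ a]

section WeilRestriction

variable {C L : Type*} [Field C] [Field L] [Algebra C L] {ι : Type*}

/-- The coordinates of an element of `L ⊗[C] S` with respect to a basis of `L` over `C`. -/
noncomputable def tensorCoord (b : Module.Basis ι C L) (S : Type*) [CommRing S] [Algebra C S]
    (i : ι) : L ⊗[C] S →ₗ[C] S :=
  (TensorProduct.lid C S).toLinearMap ∘ₗ (b.coord i).rTensor S

theorem tensorCoord_tmul (b : Module.Basis ι C L) (S : Type*) [CommRing S] [Algebra C S]
    (i : ι) (l : L) (s : S) : tensorCoord b S i (l ⊗ₜ s) = b.repr l i • s := by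
  simp [tensorCoord]

theorem sum_tmul_tensorCoord [Fintype ι] (b : Module.Basis ι C L) (S : Type*) [CommRing S] [Algebra C S]
    (z : L ⊗[C] S) : ∑ i, b i ⊗ₜ[C] tensorCoord b S i z = z := by
  induction z with
  | zero => simp
  | add x y hx hy => simp only [map_add, TensorProduct.tmul_add, Finset.sum_add_distrib, hx, hy]
  | tmul l s =>
    simp only [tensorCoord_tmul, ← TensorProduct.smul_tmul, ← TensorProduct.sum_tmul, b.sum_repr]

theorem tensorCoord_sum [Fintype ι] (b : Module.Basis ι C L) (S : Type*) [CommRing S] [Algebra C S]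
    (s : ι → S) (i : ι) : tensorCoord b S i (∑ j, b j ⊗ₜ[C] s j) = s i := by
  classical
  simp [tensorCoord_tmul, Finsupp.single_apply]

theorem tensorCoord_map (b : Module.Basis ι C L) {S T : Type*} [CommRing S] [Algebra C S]
    [CommRing T] [Algebra C T] (φ : S →ₐ[C] T) (i : ι) (z : L ⊗[C] S) :
    tensorCoord b T i (Algebra.TensorProduct.map (AlgHom.id L L) φ z) =
      φ (tensorCoord b S i z) := by
  induction z with
  | zero => simp
  | add x y hx hy => simp only [map_add, hx, hy]
  | tmul l s => simp [tensorCoord_tmul]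

theorem tensorCoord_ext [Fintype ι] (b : Module.Basis ι C L) {S : Type*} [CommRing S] [Algebra C S]
    {y z : L ⊗[C] S} (h : ∀ i, tensorCoord b S i y = tensorCoord b S i z) : y = z := by
  rw [← sum_tmul_tensorCoord b S y, ← sum_tmul_tensorCoord b S z]
  simp [h]

/-- `R`, together with the generic point `u`, is the Weil restriction of the `L`-algebra `A`
to `C`. -/
def IsWeilRestriction (C L A R : Type) [Field C] [Field L] [Algebra C L] [CommRing A]
    [Algebra L A] [CommRing R] [Algebra C R] (u : A →ₐ[L] L ⊗[C] R) : Prop :=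
  ∀ (S : Type) [CommRing S] [Algebra C S] (g : A →ₐ[L] L ⊗[C] S),
    ∃! φ : R →ₐ[C] S, (Algebra.TensorProduct.map (AlgHom.id L L) φ).comp u = g

theorem exists_isWeilRestriction (C L A : Type) [Field C] [Field L] [Algebra C L]
    [Module.Finite C L] [CommRing A] [Algebra L A] [Algebra.FiniteType L A] :
    ∃ (R : Type) (_ : CommRing R) (_ : Algebra C R) (u : A →ₐ[L] L ⊗[C] R),
      Algebra.FiniteType C R ∧ IsWeilRestriction C L A R u := by
  classical
  obtain ⟨n, f, hf⟩ := Algebra.FiniteType.iff_quotient_mvPolynomial''.mp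
    (inferInstance : Algebra.FiniteType L A)
  let b := Module.finBasis C L
  let d := Module.finrank C L
  let P := MvPolynomial (Fin n × Fin d) C
  let gen : MvPolynomial (Fin n) L →ₐ[L] L ⊗[C] P :=
    MvPolynomial.aeval fun s => ∑ i, b i ⊗ₜ[C] MvPolynomial.X (s, i)
  let J : Ideal P := Ideal.span {q | ∃ p ∈ RingHom.ker f, ∃ i, q = tensorCoord b P i (gen p)}
  let gen' : MvPolynomial (Fin n) L →ₐ[L] L ⊗[C] (P ⧸ J) :=
    (Algebra.TensorProduct.map (AlgHom.id L L) (Ideal.Quotient.mkₐ C J)).comp gen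
  have hgen' : ∀ p ∈ RingHom.ker f, gen' p = 0 := by
    intro p hp
    refine tensorCoord_ext b fun i => ?_
    rw [map_zero]
    simp only [gen', AlgHom.comp_apply]
    rw [tensorCoord_map]
    exact Ideal.Quotient.eq_zero_iff_mem.mpr (Ideal.subset_span ⟨p, hp, i, rfl⟩)
  let u : A →ₐ[L] L ⊗[C] (P ⧸ J) :=
    (Ideal.Quotient.liftₐ (RingHom.ker f) gen' hgen').comp
      (Ideal.quotientKerAlgEquivOfSurjective hf).symm.toAlgHom
  have hu : ∀ p, u (f p) = gen' p := by
    intro p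
    have : (Ideal.quotientKerAlgEquivOfSurjective hf).symm (f p) =
        Ideal.Quotient.mk (RingHom.ker f) p := by
      rw [AlgEquiv.symm_apply_eq]; rfl
    simp only [u, AlgHom.comp_apply]
    erw [this]
    rfl
  refine ⟨P ⧸ J, inferInstance, inferInstance, u, inferInstance, ?_⟩
  intro S _ _ g
  let φ₀ : P →ₐ[C] S := MvPolynomial.aeval fun x => tensorCoord b S x.2 (g (f (.X x.1)))
  have hX : ∀ x, φ₀ (.X x) = tensorCoord b S x.2 (g (f (.X x.1))) :=
    fun x => MvPolynomial.aeval_X _ _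
  have hφ₀ : (Algebra.TensorProduct.map (AlgHom.id L L) φ₀).comp gen = g.comp f := by
    refine MvPolynomial.algHom_ext fun s => ?_
    simp only [gen, AlgHom.comp_apply, MvPolynomial.aeval_X, map_sum,
      Algebra.TensorProduct.map_tmul, AlgHom.id_apply]
    exact (Finset.sum_congr rfl fun i _ => by rw [hX]).trans (sum_tmul_tensorCoord b S _)
  have hJ : ∀ q ∈ J, φ₀ q = 0 := by
    change J ≤ RingHom.ker φ₀
    refine Ideal.span_le.mpr ?_
    rintro _ ⟨p, hp, i, rfl⟩
    change φ₀ _ = 0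
    rw [← tensorCoord_map]
    have := AlgHom.congr_fun hφ₀ p
    simp only [AlgHom.comp_apply] at this
    rw [this, show f p = 0 from hp, map_zero, map_zero]
  refine ⟨Ideal.Quotient.liftₐ J φ₀ hJ, ?_, ?_⟩
  · refine AlgHom.ext fun a => ?_
    obtain ⟨p, rfl⟩ := hf a
    have := AlgHom.congr_fun hφ₀ p
    simp only [AlgHom.comp_apply] at this
    rw [AlgHom.comp_apply, hu, ← this]
    simp only [gen', AlgHom.comp_apply]
    rw [← AlgHom.comp_apply (Algebra.TensorProduct.map (AlgHom.id L L) _)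
      (Algebra.TensorProduct.map (AlgHom.id L L) _), ← Algebra.TensorProduct.map_comp]
    congr 1
  · intro ψ hψ
    refine Ideal.Quotient.algHom_ext _ (MvPolynomial.algHom_ext fun x => ?_)
    have h1 := AlgHom.congr_fun hψ (f (.X x.1))
    rw [AlgHom.comp_apply, hu] at h1
    have h2 := congrArg (tensorCoord b S x.2) h1
    rw [tensorCoord_map] at h2
    simp only [gen', AlgHom.comp_apply, tensorCoord_map] at h2
    simp only [gen, MvPolynomial.aeval_X, tensorCoord_sum] at h2
    simp only [AlgHom.comp_apply]
    rw [h2]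
    exact (hX x).symm

/-- The Weil restriction of a formally smooth algebra is formally smooth. -/
theorem IsWeilRestriction.formallySmooth {C L A R : Type} [Field C] [Field L] [Algebra C L]
    [CommRing A] [Algebra L A] [CommRing R] [Algebra C R] {u : A →ₐ[L] L ⊗[C] R}
    (h : IsWeilRestriction C L A R u) [Algebra.FormallySmooth L A] :
    Algebra.FormallySmooth C R := by
  rw [Algebra.FormallySmooth.iff_comp_surjective]
  intro B _ _ I hI φ
  let q : L ⊗[C] B →ₐ[L] L ⊗[C] (B ⧸ I) :=
    Algebra.TensorProduct.map (AlgHom.id L L) (Ideal.Quotient.mkₐ C I)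
  have hq : Function.Surjective q :=
    LinearMap.lTensor_surjective L (g := (Ideal.Quotient.mkₐ C I).toLinearMap)
      (Ideal.Quotient.mkₐ_surjective C I)
  have hker : RingHom.ker q = I.map (Algebra.TensorProduct.includeRight : B →ₐ[C] L ⊗[C] B) := by
    have := Algebra.TensorProduct.lTensor_ker (A := L) (Ideal.Quotient.mkₐ C I)
      (Ideal.Quotient.mkₐ_surjective C I)
    rwa [show RingHom.ker (Ideal.Quotient.mkₐ C I) = I by
      ext; simp [RingHom.mem_ker, Ideal.Quotient.eq_zero_iff_mem] ] at this
  have hnil : IsNilpotent (RingHom.ker (q : L ⊗[C] B →+* L ⊗[C] (B ⧸ I))) := by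
    refine ⟨2, ?_⟩
    change (RingHom.ker q) ^ 2 = ⊥
    rw [hker, ← Ideal.map_pow, hI, Ideal.map_bot]
  let g := Algebra.FormallySmooth.liftOfSurjective
    ((Algebra.TensorProduct.map (AlgHom.id L L) φ).comp u) q hq hnil
  have hg : q.comp g = (Algebra.TensorProduct.map (AlgHom.id L L) φ).comp u :=
    Algebra.FormallySmooth.comp_liftOfSurjective _ q hq hnil
  obtain ⟨ψ, hψ, -⟩ := h B g
  refine ⟨ψ, (h (B ⧸ I) _).unique ?_ rfl⟩
  rw [← hg, ← hψ, ← AlgHom.comp_assoc]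
  congr 1
  rw [← AlgHom.id_comp (AlgHom.id L L), Algebra.TensorProduct.map_comp]
  rfl

end WeilRestriction

section WeilRestriction

variable {C L k : Type*} [Field C] [Field L] [Algebra C L] [Field k] [Algebra C k]

/-- The map `L ⊗[C] S → S` induced by an embedding of `L` in `k`, for a `k`-algebra `S`. -/
noncomputable def tensorEval (σ : L →ₐ[C] k) (S : Type*) [CommRing S] [Algebra C S] [Algebra k S]
    [IsScalarTower C k S] : L ⊗[C] S →ₐ[C] S :=
  Algebra.TensorProduct.productMap ((IsScalarTower.toAlgHom C k S).comp σ) (AlgHom.id C S)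

theorem tensorEval_tmul (σ : L →ₐ[C] k) (S : Type*) [CommRing S] [Algebra C S] [Algebra k S]
    [IsScalarTower C k S] (l : L) (s : S) :
    tensorEval σ S (l ⊗ₜ s) = algebraMap k S (σ l) * s := by
  simp [tensorEval]

theorem tensorEval_map (σ : L →ₐ[C] k) {S T : Type*} [CommRing S] [Algebra C S] [Algebra k S]
    [IsScalarTower C k S] [CommRing T] [Algebra C T] [Algebra k T]
    [IsScalarTower C k T] (φ : S →ₐ[k] T) (z : L ⊗[C] S) :
    tensorEval σ T (Algebra.TensorProduct.map (AlgHom.id L L) (φ.restrictScalars C) z) =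
      φ (tensorEval σ S z) := by
  induction z with
  | zero => simp
  | add x y hx hy => simp only [map_add, hx, hy]
  | tmul l s => simp [tensorEval_tmul]

theorem tensorEval_bijective [IsAlgClosed k] [Module.Finite C L] [Algebra.IsSeparable C L]
    (S : Type*) [CommRing S] [Algebra C S] [Algebra k S] [IsScalarTower C k S] :
    Function.Bijective fun (z : L ⊗[C] S) (σ : L →ₐ[C] k) => tensorEval σ S z := by
  classical
  let b := Module.finBasis C L
  let d := Module.finrank C L
  have hcard : Fintype.card (Fin d) = Fintype.card (L →ₐ[C] k) := by
    rw [Fintype.card_fin, AlgHom.card]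
  let e : Fin d ≃ (L →ₐ[C] k) := Fintype.equivOfCardEq hcard
  let M : Matrix (Fin d) (Fin d) k := Matrix.of fun i j => e j (b i)
  have hM : IsUnit M.det := by
    have h1 := Algebra.discr_eq_det_embeddingsMatrixReindex_pow_two C k b e
    have h2 := Algebra.discr_not_zero_of_basis C b
    rw [isUnit_iff_ne_zero]
    intro h0
    have h3 : Algebra.embeddingsMatrixReindex C k b e = M := by
      ext i j; rfl
    rw [h3, h0] at h1
    exact h2 (by simpa using h1)
  have hev : ∀ (z : L ⊗[C] S) j, tensorEval (e j) S z =
      ∑ i, algebraMap k S (M i j) * tensorCoord b S i z := by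
    intro z j
    conv_lhs => rw [← sum_tmul_tensorCoord b S z]
    simp [tensorEval_tmul, M]
    rfl
  have hMN : M * M⁻¹ = 1 := Matrix.mul_nonsing_inv _ hM
  have hNM : M⁻¹ * M = 1 := Matrix.nonsing_inv_mul _ hM
  constructor
  · intro y z hyz
    refine tensorCoord_ext b fun i' => ?_
    have key : ∀ z : L ⊗[C] S, tensorCoord b S i' z =
        ∑ j, algebraMap k S (M⁻¹ j i') * tensorEval (e j) S z := by
      intro z
      simp_rw [hev, Finset.mul_sum]
      rw [Finset.sum_comm]
      simp_rw [← mul_assoc, ← map_mul, mul_comm (M⁻¹ _ _), ← Finset.sum_mul, ← map_sum,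
        ← Matrix.mul_apply, hMN]
      simp [Matrix.one_apply, apply_ite (algebraMap k S)]
    rw [key y, key z]
    exact Finset.sum_congr rfl fun j _ =>
      congrArg (algebraMap k S (M⁻¹ j i') * ·) (congrFun hyz (e j))
  · intro t
    refine ⟨∑ i, b i ⊗ₜ[C] ∑ j, algebraMap k S (M⁻¹ j i) * t (e j), funext fun σ => ?_⟩
    obtain ⟨j, rfl⟩ := e.surjective σ
    change tensorEval (e j) S _ = _
    rw [hev]
    simp_rw [tensorCoord_sum, Finset.mul_sum]
    rw [Finset.sum_comm]
    simp_rw [← mul_assoc, ← map_mul, mul_comm (M _ _), ← Finset.sum_mul, ← map_sum,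
      ← Matrix.mul_apply, hNM]
    simp [Matrix.one_apply, apply_ite (algebraMap k S)]

/-- If `k ⊗[L] A` is a domain for some algebraic closure `k` of `L`, then so is its analogue for
every algebraic closure `k'` of `L`; we record its universal property. -/
theorem exists_isDomain_baseChange (L k k' A : Type) [Field L] [Field k] [Field k'] [Algebra L k]
    [Algebra L k'] [IsAlgClosure L k] [IsAlgClosure L k'] [CommRing A] [Algebra L A]
    [Algebra.FiniteType L A] [IsDomain (k ⊗[L] A)] :
    ∃ (B : Type) (_ : CommRing B) (_ : Algebra k' B) (j : A →+* B), IsDomain B ∧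
      Algebra.FiniteType k' B ∧
      (∀ l, j (algebraMap L A l) = algebraMap k' B (algebraMap L k' l)) ∧
      ∀ (S : Type) [CommRing S] [Algebra k' S] (g : A →+* S),
        (∀ l, g (algebraMap L A l) = algebraMap k' S (algebraMap L k' l)) →
        ∃ φ : B →ₐ[k'] S, ∀ a, φ (j a) = g a := by
  let τ : k ≃ₐ[L] k' := IsAlgClosure.equiv L k k'
  have hdom : IsDomain (k' ⊗[L] A) :=
    (Algebra.TensorProduct.congr τ (AlgEquiv.refl (R := L) (A₁ := A))).toMulEquiv.symm.isDomain _
  refine ⟨k' ⊗[L] A, inferInstance, inferInstance,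
    (Algebra.TensorProduct.includeRight : A →ₐ[L] k' ⊗[L] A), hdom, inferInstance, ?_, ?_⟩
  · intro l
    simp only [RingHom.coe_coe, AlgHom.commutes]
    rw [IsScalarTower.algebraMap_apply L k' (k' ⊗[L] A)]
  · intro S _ _ g hg
    let : Algebra L S := ((algebraMap k' S).comp (algebraMap L k')).toAlgebra
    have : IsScalarTower L k' S := IsScalarTower.of_algebraMap_eq fun _ => rfl
    let g' : A →ₐ[L] S := { g with commutes' := hg }
    exact ⟨Algebra.TensorProduct.lift (Algebra.ofId k' S) g' fun _ _ => .all _ _,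
      fun a => by simp [g']⟩

/-- The Weil restriction of a geometrically integral algebra along a finite separable extension
is geometrically integral. -/
theorem IsWeilRestriction.isDomain {C L k A R : Type} [Field C] [Field L] [Algebra C L]
    [Module.Finite C L] [Algebra.IsSeparable C L] [Field k] [Algebra C k] [Algebra L k]
    [IsScalarTower C L k] [IsAlgClosure C k]
    [CommRing A] [Algebra L A] [Algebra.FiniteType L A] [IsDomain (k ⊗[L] A)]
    [CommRing R] [Algebra C R] {u : A →ₐ[L] L ⊗[C] R} (h : IsWeilRestriction C L A R u) :
    IsDomain (k ⊗[C] R) := by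
  have hk : IsAlgClosed k := IsAlgClosure.isAlgClosed C
  have hCk : Algebra.IsAlgebraic C k := IsAlgClosure.isAlgebraic
  have hLk : IsAlgClosure L k := ⟨hk, Algebra.IsAlgebraic.tower_top (K := C) L⟩
  have htw : ∀ σ : L →ₐ[C] k, ∃ (B : Type) (_ : CommRing B) (_ : Algebra k B) (j : A →+* B),
      IsDomain B ∧ Algebra.FiniteType k B ∧
      (∀ l, j (algebraMap L A l) = algebraMap k B (σ l)) ∧
      ∀ (S : Type) [CommRing S] [Algebra k S] (g : A →+* S),
        (∀ l, g (algebraMap L A l) = algebraMap k S (σ l)) →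
        ∃ φ : B →ₐ[k] S, ∀ a, φ (j a) = g a := by
    intro σ
    have hσ : @IsAlgClosure L k _ _ σ.toRingHom.toAlgebra _ := by
      let := σ.toRingHom.toAlgebra
      have : IsScalarTower C L k := IsScalarTower.of_algebraMap_eq fun c => (σ.commutes c).symm
      exact ⟨hk, Algebra.IsAlgebraic.tower_top (K := C) L⟩
    exact @exists_isDomain_baseChange L k k A _ _ _ _ σ.toRingHom.toAlgebra _ hσ _ _ _ _
  choose B _ _ j hB hBfin hj hlift using htw
  obtain ⟨D, _, _, i, hD, hi⟩ := exists_isDomain_coproduct k (L →ₐ[C] k) B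
  let : Algebra C D := Algebra.compHom D (algebraMap C k)
  have : IsScalarTower C k D := IsScalarTower.of_algebraMap_eq fun _ => rfl
  -- the map from the Weil restriction to the product of the conjugates
  let evD : L ⊗[C] D ≃+* ((L →ₐ[C] k) → D) := RingEquiv.ofBijective
    (RingHom.pi fun σ => (tensorEval σ D).toRingHom) (tensorEval_bijective D)
  have hevD : ∀ z σ, evD z σ = tensorEval σ D z := fun _ _ => rfl
  let g₀ : A →+* L ⊗[C] D := evD.symm.toRingHom.comp
    (RingHom.pi fun σ => (i σ).toRingHom.comp (j σ))
  have hg₀ : ∀ a σ, tensorEval σ D (g₀ a) = i σ (j σ a) := by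
    intro a σ
    exact congrFun (evD.apply_symm_apply _) σ
  let g : A →ₐ[L] L ⊗[C] D := { g₀ with
    commutes' := fun l => evD.injective (funext fun σ => by
      refine (hg₀ _ σ).trans ?_
      rw [hevD, hj, Algebra.TensorProduct.algebraMap_apply, tensorEval_tmul]
      simp) }
  obtain ⟨Φ₀, hΦ₀, -⟩ := h D g
  let Φ : k ⊗[C] R →ₐ[k] D :=
    Algebra.TensorProduct.lift (Algebra.ofId k D) Φ₀ fun _ _ => .all _ _
  let inc : R →ₐ[C] k ⊗[C] R := Algebra.TensorProduct.includeRight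
  let w : A →ₐ[L] L ⊗[C] (k ⊗[C] R) := (Algebra.TensorProduct.map (AlgHom.id L L) inc).comp u
  have hw : ∀ σ : L →ₐ[C] k, ∃ φ : B σ →ₐ[k] k ⊗[C] R,
      ∀ a, φ (j σ a) = tensorEval σ (k ⊗[C] R) (w a) := by
    intro σ
    refine hlift σ (k ⊗[C] R) ((tensorEval σ (k ⊗[C] R)).toRingHom.comp w.toRingHom) fun l => ?_
    simp [tensorEval_tmul, Algebra.TensorProduct.algebraMap_apply]
  choose φ hφ using hw
  obtain ⟨Ψ, hΨ⟩ := hi (k ⊗[C] R) φ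
  have hΦinc : (Φ.restrictScalars C).comp inc = Φ₀ := by
    ext r; simp [Φ, inc]
  have hcomp : ((Ψ.comp Φ).restrictScalars C).comp inc = inc := by
    refine (h (k ⊗[C] R) w).unique ?_ rfl
    refine AlgHom.ext fun a => (tensorEval_bijective (k := k) (k ⊗[C] R)).1 (funext fun σ => ?_)
    have e1 : ((Ψ.comp Φ).restrictScalars C).comp inc = (Ψ.restrictScalars C).comp Φ₀ := by
      rw [← hΦinc]; rfl
    have e2 : Algebra.TensorProduct.map (AlgHom.id L L) ((Ψ.restrictScalars C).comp Φ₀) =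
        (Algebra.TensorProduct.map (AlgHom.id L L) (Ψ.restrictScalars C)).comp
          (Algebra.TensorProduct.map (AlgHom.id L L) Φ₀) := by
      rw [← Algebra.TensorProduct.map_comp]; rfl
    have e3 : Algebra.TensorProduct.map (AlgHom.id L L) Φ₀ (u a) = g₀ a :=
      AlgHom.congr_fun hΦ₀ a
    simp only [AlgHom.comp_apply]
    rw [e1, e2, AlgHom.comp_apply, e3, tensorEval_map, hg₀, ← hφ]
    exact AlgHom.congr_fun (hΨ σ) _
  have hid : Ψ.comp Φ = AlgHom.id k _ :=
    Algebra.TensorProduct.ext (AlgHom.ext fun x => by simp [Φ]) hcomp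
  have hinj : Function.Injective Φ := fun x y hxy => by
    have := congrArg Ψ hxy
    rwa [← AlgHom.comp_apply, ← AlgHom.comp_apply, hid] at this
  exact hinj.isDomain Φ.toRingHom

end WeilRestriction

section SeparablyGenerated

/-- The easy direction of Mac Lane's criterion. -/
theorem linearIndepOn_pow_of_isReduced_tensorProduct {C F : Type*} [Field C] [Field F] [Algebra C F]
    [IsReduced (F ⊗[C] AlgebraicClosure C)] (p : ℕ) (hp : p.Prime) [CharP C p] (s : Finset F)
    (hs : LinearIndepOn C id (s : Set F)) : LinearIndepOn C (· ^ p) (s : Set F) := by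
  have : Fact p.Prime := ⟨hp⟩
  let k := AlgebraicClosure C
  have hpk : CharP (F ⊗[C] k) p := charP_of_injective_algebraMap (algebraMap C _).injective p
  have : ExpChar (F ⊗[C] k) p := .prime hp
  rw [linearIndepOn_finset_iff] at hs ⊢
  intro c hc
  have hroot : ∀ x, ∃ d : k, d ^ p = algebraMap C k (c x) := fun x =>
    IsAlgClosed.exists_pow_nat_eq _ hp.pos
  choose d hd using hroot
  have h1 : (∑ x ∈ s, x ⊗ₜ[C] d x) ^ p = 0 := by
    rw [sum_pow_char]
    simp_rw [Algebra.TensorProduct.tmul_pow, hd, Algebra.algebraMap_eq_smul_one,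
      ← TensorProduct.smul_tmul, ← TensorProduct.sum_tmul, hc, TensorProduct.zero_tmul]
  have h2 : ∑ x ∈ s, x ⊗ₜ[C] d x = 0 := by
    exact eq_zero_of_pow_eq_zero h1
  have h3 : LinearIndependent k ((1 : k) ⊗ₜ[C] (Subtype.val : s → F) ·) :=
    Module.Flat.linearIndependent_one_tmul (linearIndepOn_finset_iff.mpr hs)
  have h4 : ∑ x : s, d x.1 • ((1 : k) ⊗ₜ[C] x.1) = 0 := by
    have := congrArg (TensorProduct.comm C F k) h2
    rw [map_sum, map_zero, ← Finset.sum_attach] at this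
    simpa [TensorProduct.smul_tmul'] using this
  intro x hx
  have h5 : d x = 0 := Fintype.linearIndependent_iff.mp h3 (fun x => d x.1) h4 ⟨x, hx⟩
  have := hd x
  rw [h5, zero_pow hp.ne_zero] at this
  exact (algebraMap C k).injective (by rw [← this, map_zero])

theorem exists_isTranscendenceBasis_and_isSeparable_adjoin {C F : Type*} [Field C] [Field F]
    [Algebra C F] [IsReduced (F ⊗[C] AlgebraicClosure C)] (E : IntermediateField C F)
    [Algebra.EssFiniteType C E] :
    ∃ s : Finset E, IsTranscendenceBasis C ((↑) : s → E) ∧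
      Algebra.IsSeparable (IntermediateField.adjoin C (s : Set E)) E := by
  obtain _ | ⟨p, hp, hpk⟩ := CharP.exists' C
  · exact exists_isTranscendenceBasis_and_isSeparable_of_perfectField C E
  · classical
    refine exists_isTranscendenceBasis_and_isSeparable_of_linearIndepOn_pow_of_essFiniteType
      p hp.out fun s hs => ?_
    have h1 : LinearIndepOn C id ((s.image (algebraMap E F) : Finset F) : Set F) := by
      rw [Finset.coe_image]
      exact (hs.map_injOn (Algebra.ofId E F |>.toLinearMap.restrictScalars C)
        ((algebraMap E F).injective.injOn)).id_image
    have h2 := linearIndepOn_pow_of_isReduced_tensorProduct p hp.out _ h1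
    rw [Finset.coe_image] at h2
    have h3 : LinearIndepOn C ((Algebra.ofId E F |>.toLinearMap.restrictScalars C) ∘ (· ^ p))
        (s : Set E) := by
      have := h2.comp_of_image (algebraMap E F).injective.injOn
      refine (linearIndepOn_congr ?_).mp this
      intro x _
      simp [Algebra.ofId_apply]
    exact h3.of_comp _

end SeparablyGenerated

section StandardEtale

/-- Evaluation of polynomials in the variables `σ` and one more variable. -/
noncomputable def evalMvPoly {σ k S : Type*} [CommRing k] [CommRing S] [Algebra k S] (t : σ → S)
    (y : S) : Polynomial (MvPolynomial σ k) →+* S :=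
  Polynomial.eval₂RingHom (MvPolynomial.aeval t : MvPolynomial σ k →ₐ[k] S).toRingHom y

theorem evalMvPoly_map {σ L k S : Type*} [CommRing L] [CommRing k] [Algebra L k] [CommRing S]
    [Algebra k S] [Algebra L S] [IsScalarTower L k S] (t : σ → S) (y : S)
    (p : Polynomial (MvPolynomial σ L)) :
    evalMvPoly (k := k) t y (p.map (MvPolynomial.map (algebraMap L k))) =
      evalMvPoly (k := L) t y p := by
  have : (evalMvPoly (k := k) t y).comp (Polynomial.mapRingHom (MvPolynomial.map (algebraMap L k)))
      = evalMvPoly (k := L) t y := by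
    refine Polynomial.ringHom_ext' (MvPolynomial.ringHom_ext ?_ ?_) ?_
    · intro l
      simp [evalMvPoly, ← IsScalarTower.algebraMap_apply]
    · simp [evalMvPoly]
    · simp [evalMvPoly]
  exact RingHom.congr_fun this p

theorem map_evalMvPoly {σ k S T : Type*} [CommRing k] [CommRing S] [Algebra k S] [CommRing T]
    [Algebra k T] (φ : S →ₐ[k] T) (t : σ → S) (y : S) (p : Polynomial (MvPolynomial σ k)) :
    φ (evalMvPoly t y p) = evalMvPoly (φ ∘ t) (φ y) p := by
  have : φ.toRingHom.comp (evalMvPoly t y) = evalMvPoly (k := k) (φ ∘ t) (φ y) := by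
    refine Polynomial.ringHom_ext' (MvPolynomial.ringHom_ext ?_ ?_) ?_
    · intro l
      simp [evalMvPoly]
    · simp [evalMvPoly]
    · simp [evalMvPoly]
  exact RingHom.congr_fun this p

theorem aeval_eq_evalMvPoly {σ L : Type*} [CommRing L]
    {A : Type*} [CommRing A] [Algebra L A]
    [Algebra (MvPolynomial σ L) A] [IsScalarTower L (MvPolynomial σ L) A] (x : A)
    (p : Polynomial (MvPolynomial σ L)) :
    Polynomial.aeval x p =
      evalMvPoly (fun i => algebraMap (MvPolynomial σ L) A (.X i)) x p := by
  have : (Polynomial.aeval x).toRingHom =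
      evalMvPoly (k := L) (fun i => algebraMap (MvPolynomial σ L) A (.X i)) x := by
    refine Polynomial.ringHom_ext' (MvPolynomial.ringHom_ext ?_ ?_) ?_
    · intro l
      simp [evalMvPoly, IsScalarTower.algebraMap_apply L (MvPolynomial σ L) A,
        MvPolynomial.algebraMap_eq]
    · simp [evalMvPoly]
    · simp [evalMvPoly]
  exact RingHom.congr_fun this p

theorem StandardEtalePresentation.productMap_injective {σ L k Ω : Type*} [Field L] [Field k] [Algebra L k]
    [CommRing Ω] [Algebra L Ω] [Algebra k Ω] [IsScalarTower L k Ω]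
    {A : Type*} [CommRing A] [Algebra L A]
    [Algebra (MvPolynomial σ L) A] [IsScalarTower L (MvPolynomial σ L) A]
    (P : StandardEtalePresentation (MvPolynomial σ L) A) (j : A →ₐ[L] Ω)
    (H : ∀ q : Polynomial (MvPolynomial σ k), q.natDegree < P.f.natDegree →
      evalMvPoly (fun i => j (algebraMap (MvPolynomial σ L) A (.X i))) (j P.x) q = 0 → q = 0) :
    Function.Injective (Algebra.TensorProduct.lift (Algebra.ofId k Ω) j fun _ _ => .all _ _) := by
  set φ := Algebra.TensorProduct.lift (Algebra.ofId k Ω) j fun _ _ => .all _ _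
  let inc : A →ₐ[L] k ⊗[L] A := Algebra.TensorProduct.includeRight
  let t := fun i => algebraMap (MvPolynomial σ L) A (.X i)
  let π : Polynomial (MvPolynomial σ k) →+* k ⊗[L] A := evalMvPoly (inc ∘ t) (inc P.x)
  have hinc : ∀ p : Polynomial (MvPolynomial σ L),
      π (p.map (MvPolynomial.map (algebraMap L k))) = inc (Polynomial.aeval P.x p) := by
    intro p
    rw [aeval_eq_evalMvPoly, map_evalMvPoly]
    exact evalMvPoly_map _ _ p
  have hsurj : ∀ z, ∃ q n, z * inc (Polynomial.aeval P.x P.g) ^ n = π q := by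
    intro z
    induction z with
    | zero => exact ⟨0, 0, by simp⟩
    | add x y hx hy =>
      obtain ⟨q, n, hq⟩ := hx
      obtain ⟨r, m, hr⟩ := hy
      let g := P.g.map (MvPolynomial.map (algebraMap L k))
      refine ⟨q * g ^ m + r * g ^ n, n + m, ?_⟩
      rw [map_add, map_mul, map_mul, map_pow, map_pow, hinc, ← hq, ← hr]
      ring
    | tmul c x =>
      obtain ⟨p, n, hp⟩ := P.exists_mul_aeval_x_g_pow_eq_aeval_x x
      refine ⟨.C (.C c) * p.map (MvPolynomial.map (algebraMap L k)), n, ?_⟩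
      rw [map_mul, hinc, ← hp]
      simp [π, evalMvPoly, inc]
  rw [injective_iff_map_eq_zero]
  intro z hz
  obtain ⟨q, n, hq⟩ := hsurj z
  have hφπ : ∀ q, φ (π q) = evalMvPoly (fun i => j (t i)) (j P.x) q := by
    intro q
    rw [map_evalMvPoly]
    congr 2
    · ext i; simp [φ, inc]
    · simp [φ, inc]
  let f := P.f.map (MvPolynomial.map (algebraMap L k))
  have hf : f.Monic := P.monic_f.map _
  have hπf : π f = 0 := by rw [hinc, P.hasMap.1, map_zero]
  have hdiv := Polynomial.modByMonic_add_div q f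
  have hr : q %ₘ f = 0 := by
    by_cases h1 : f = 1
    · rw [h1, Polynomial.modByMonic_one]
    refine H _ ?_ ?_
    · rw [← P.monic_f.natDegree_map (MvPolynomial.map (algebraMap L k))]
      exact Polynomial.natDegree_modByMonic_lt q hf h1
    · rw [← hφπ]
      have : π (q %ₘ f) = π q := by
        conv_rhs => rw [← hdiv, map_add, map_mul, hπf, zero_mul, add_zero]
      rw [this, ← hq, map_mul, hz, zero_mul]
  have h0 : z * inc (Polynomial.aeval P.x P.g) ^ n = 0 := by
    rw [hq, ← hdiv, hr, zero_add, map_mul, hπf, zero_mul]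
  exact (((P.hasMap.2.map inc).pow n).mul_left_eq_zero).mp h0

end StandardEtale

section MinimalPolynomial

theorem mem_range_of_isSeparable_of_forall_algEquiv {F Ω : Type*} [Field F] [Field Ω] [Algebra F Ω]
    [Normal F Ω] {x : Ω} (hx : IsSeparable F x) (h : ∀ τ : Ω ≃ₐ[F] Ω, τ x = x) :
    x ∈ (algebraMap F Ω).range := by
  classical
  have hint : IsIntegral F x := hx.isIntegral
  have hsplit := Normal.splits (F := F) (K := Ω) inferInstance x
  have hroots : ∀ y ∈ (minpoly F x).aroots Ω, y = x := by
    intro y hy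
    obtain ⟨τ, hτ⟩ := minpoly.exists_algEquiv_of_root' hint.isAlgebraic
      ((Polynomial.mem_aroots.mp hy).2)
    rw [← hτ, h]
  have hnodup : ((minpoly F x).aroots Ω).Nodup := Polynomial.nodup_roots
    (Polynomial.Separable.map (show (minpoly F x).Separable from hx))
  have hcard : ((minpoly F x).aroots Ω).card ≤ 1 := by
    have h1 := Multiset.nodup_iff_count_le_one.mp hnodup x
    rwa [Multiset.count_eq_card.mpr fun y hy => (hroots y hy).symm] at h1
  refine minpoly.mem_range_of_degree_eq_one F x ?_
  have h1 : (minpoly F x).natDegree ≤ 1 := by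
    rw [← (minpoly F x).natDegree_map (algebraMap F Ω), hsplit.natDegree_eq_card_roots]
    exact hcard
  have h2 := minpoly.natDegree_pos hint
  rw [Polynomial.degree_eq_natDegree (minpoly.ne_zero hint)]
  exact_mod_cast (by omega : (minpoly F x).natDegree = 1)

theorem isSeparable_of_aeval_derivative_ne_zero {F Ω : Type*} [Field F] [Field Ω] [Algebra F Ω]
    {x : Ω} {p : Polynomial F} (h0 : Polynomial.aeval x p = 0)
    (h1 : Polynomial.aeval x p.derivative ≠ 0) : IsSeparable F x := by
  have hp : p ≠ 0 := by rintro rfl; simp at h1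
  have hint : IsIntegral F x := (show IsAlgebraic F x from ⟨p, hp, h0⟩).isIntegral
  rw [IsSeparable, Polynomial.separable_iff_derivative_ne_zero (minpoly.irreducible hint)]
  intro hd
  obtain ⟨q, rfl⟩ := minpoly.dvd F x h0
  exact h1 (by simp [hd])

open IntermediateField.algebraAdjoinAdjoin in
/-- The minimal polynomial of an integral element over a polynomial ring. -/
theorem exists_monic_evalMvPoly_eq_zero {σ E Ω : Type*} [Field E] [Field Ω] [Algebra E Ω]
    {t : σ → Ω} (ht : AlgebraicIndependent E t) {y : Ω}
    (hint : IsIntegral (Algebra.adjoin E (Set.range t)) y) 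
    (hsep : IsSeparable (IntermediateField.adjoin E (Set.range t)) y) :
    ∃ g : Polynomial (MvPolynomial σ E), g.Monic ∧ evalMvPoly t y g = 0 ∧
      evalMvPoly t y g.derivative ≠ 0 ∧
      g.natDegree = (minpoly (IntermediateField.adjoin E (Set.range t)) y).natDegree := by
  set B := Algebra.adjoin E (Set.range t)
  set K := IntermediateField.adjoin E (Set.range t)
  let e : MvPolynomial σ E ≃ₐ[E] B := ht.aevalEquiv
  have : IsIntegrallyClosed B := IsIntegrallyClosed.of_equiv e.toRingEquiv
  have hmin := minpoly.isIntegrallyClosed_eq_field_fractions' K hint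
  have hev : ∀ p : Polynomial B,
      evalMvPoly t y (p.map (e.symm : B →+* MvPolynomial σ E)) = Polynomial.aeval y p := by
    intro p
    have h1 : ∀ b : B, MvPolynomial.aeval t (e.symm b) = (b : Ω) := by
      intro b
      obtain ⟨q, rfl⟩ := e.surjective b
      rw [AlgEquiv.symm_apply_apply]
      exact (ht.algebraMap_aevalEquiv q).symm
    rw [evalMvPoly, Polynomial.coe_eval₂RingHom, Polynomial.eval₂_map, Polynomial.aeval_def]
    congr 1
    ext b
    exact h1 b
  refine ⟨(minpoly B y).map (e.symm : B →+* MvPolynomial σ E), (minpoly.monic hint).map _, ?_, ?_, ?_⟩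
  · rw [hev, minpoly.aeval]
  · rw [Polynomial.derivative_map, hev, ← Polynomial.aeval_map_algebraMap K,
      ← Polynomial.derivative_map, ← hmin]
    exact Polynomial.Separable.aeval_derivative_ne_zero hsep (minpoly.aeval _ _)
  · rw [hmin, (minpoly.monic hint).natDegree_map, (minpoly.monic hint).natDegree_map]

open IntermediateField.algebraAdjoinAdjoin in
theorem exists_monic_evalMvPoly_minimal {σ E k Ω : Type*} [Field E] [Field k] [Field Ω]
    [Algebra E Ω] [Algebra E k] [Algebra k Ω] [IsScalarTower E k Ω] [IsPurelyInseparable E k]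
    {t : σ → Ω} (ht : AlgebraicIndependent E t) {y : Ω} {p : Polynomial (MvPolynomial σ E)}
    (hp : p.Monic) (h0 : evalMvPoly t y p = 0) (h1 : evalMvPoly t y p.derivative ≠ 0) :
    ∃ g : Polynomial (MvPolynomial σ E), g.Monic ∧ evalMvPoly t y g = 0 ∧
      evalMvPoly t y g.derivative ≠ 0 ∧
      ∀ q : Polynomial (MvPolynomial σ k), q.natDegree < g.natDegree →
        evalMvPoly t y q = 0 → q = 0 := by
  set B := Algebra.adjoin E (Set.range t) with hB
  set K := IntermediateField.adjoin E (Set.range t) with hK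
  let ψ : MvPolynomial σ E →+* B := (ht.aevalEquiv : MvPolynomial σ E ≃ₐ[E] B)
  have hψ : ∀ p : Polynomial (MvPolynomial σ E),
      Polynomial.aeval y (p.map ψ) = evalMvPoly t y p := by
    intro p
    rw [evalMvPoly, Polynomial.coe_eval₂RingHom, Polynomial.aeval_def, Polynomial.eval₂_map]
    congr 1
  have hint : IsIntegral B y := ⟨p.map ψ, hp.map _, (hψ p).trans h0⟩
  have hsep : IsSeparable K y := by
    refine isSeparable_of_aeval_derivative_ne_zero (p := (p.map ψ).map (algebraMap B K)) ?_ ?_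
    · rw [Polynomial.aeval_map_algebraMap, hψ, h0]
    · rw [Polynomial.derivative_map, Polynomial.aeval_map_algebraMap, Polynomial.derivative_map, hψ]
      assumption
  obtain ⟨g, hg, hg0, hg1, hgd⟩ := exists_monic_evalMvPoly_eq_zero ht hint hsep
  refine ⟨g, hg, hg0, hg1, fun q hq hq0 => ?_⟩
  let K₂ := IntermediateField.adjoin K (Set.range (algebraMap k Ω))
  have hpi : IsPurelyInseparable K K₂ := by
    let r := ringExpChar E
    have : ExpChar E r := inferInstance
    have : ExpChar K r := expChar_of_injective_algebraMap (algebraMap E K).injective r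
    rw [IntermediateField.isPurelyInseparable_adjoin_iff_pow_mem _ _ r]
    rintro _ ⟨c, rfl⟩
    obtain ⟨n, d, hd⟩ := IsPurelyInseparable.pow_mem E r c
    refine ⟨n, algebraMap E K d, ?_⟩
    rw [← map_pow, ← hd, ← IsScalarTower.algebraMap_apply, ← IsScalarTower.algebraMap_apply]
  have hmin := minpoly.map_eq_of_isSeparable_of_isPurelyInseparable K₂ y hsep
  have hmem : ∀ c : MvPolynomial σ k, MvPolynomial.aeval t c ∈ K₂ := by
    intro c
    induction c using MvPolynomial.induction_on with
    | C a =>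
      rw [MvPolynomial.aeval_C]
      exact IntermediateField.subset_adjoin K _ ⟨a, rfl⟩
    | add p q hp hq => rw [map_add]; exact add_mem hp hq
    | mul_X p i hp =>
      rw [map_mul, MvPolynomial.aeval_X]
      exact mul_mem hp (K₂.algebraMap_mem ⟨t i, IntermediateField.subset_adjoin E _ ⟨i, rfl⟩⟩)
  let χ : MvPolynomial σ k →+* K₂ := RingHom.codRestrict
    (MvPolynomial.aeval t : MvPolynomial σ k →ₐ[k] Ω).toRingHom K₂ hmem
  have hχ : Function.Injective χ := by
    have htk : AlgebraicIndependent k t := ht.extendScalars k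
    intro a b hab
    exact htk (congrArg Subtype.val hab)
  have hq1 : Polynomial.aeval y (q.map χ) = 0 := by
    rw [← hq0, evalMvPoly, Polynomial.coe_eval₂RingHom, Polynomial.aeval_def, Polynomial.eval₂_map]
    rfl
  have hq2 : q.map χ = 0 := by
    refine Polynomial.eq_zero_of_dvd_of_natDegree_lt (minpoly.dvd K₂ y hq1) ?_
    have hgd' : g.natDegree = (minpoly K y).natDegree := hgd
    rw [← hmin, (minpoly.monic hsep.isIntegral).natDegree_map, ← hgd']
    exact (Polynomial.natDegree_map_le).trans_lt hq
  exact (Polynomial.map_eq_zero_iff hχ).mp hq2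

end MinimalPolynomial

section Descent

/-- Descent of a minimal polynomial to a finite separable extension of `C` inside `F`. -/
theorem exists_finite_separable_monic_minimal {σ C F M k Ω : Type*} [Field C] [Field F] [Field M]
    [Field k] [Field Ω] [Algebra C F] [Algebra C M] [Algebra C k] [Algebra C Ω]
    [Algebra F Ω] [Algebra M k] [Algebra M Ω] [Algebra k Ω] [IsScalarTower C F Ω]
    [IsScalarTower C M k] [IsScalarTower C M Ω] [IsScalarTower M k Ω] [IsScalarTower C k Ω]
    [Normal C M] [Algebra.IsSeparable C M] [IsPurelyInseparable M k] [IsAlgClosed k]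
    [Normal F Ω]
    {t : σ → F} (ht : AlgebraicIndependent C t) {y : F} {p : Polynomial (MvPolynomial σ C)}
    (hp : p.Monic) (h0 : evalMvPoly t y p = 0) (h1 : evalMvPoly t y p.derivative ≠ 0) :
    ∃ (L : IntermediateField C F) (_ : Algebra L k), Module.Finite C L ∧ Algebra.IsSeparable C L ∧
      IsScalarTower C L k ∧ IsScalarTower L k Ω ∧
      ∃ f : Polynomial (MvPolynomial σ L), f.Monic ∧ evalMvPoly t y f = 0 ∧
        evalMvPoly t y f.derivative ≠ 0 ∧
        ∀ q : Polynomial (MvPolynomial σ k), q.natDegree < f.natDegree →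
          evalMvPoly (algebraMap F Ω ∘ t) (algebraMap F Ω y) q = 0 → q = 0 := by
  classical
  set t' : σ → Ω := algebraMap F Ω ∘ t
  set y' : Ω := algebraMap F Ω y
  have htC : AlgebraicIndependent C t' :=
    ht.map' (f := IsScalarTower.toAlgHom C F Ω) (algebraMap F Ω).injective
  have htM : AlgebraicIndependent M t' := htC.extendScalars M
  have hpM : ∀ p : Polynomial (MvPolynomial σ C),
      evalMvPoly t' y' (p.map (MvPolynomial.map (algebraMap C M))) =
        algebraMap F Ω (evalMvPoly t y p) := by
    intro p
    rw [evalMvPoly_map]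
    exact (map_evalMvPoly (IsScalarTower.toAlgHom C F Ω) t y p).symm
  obtain ⟨g, hg, hg0, hg1, hmin⟩ := exists_monic_evalMvPoly_minimal (k := k) htM
    (hp.map (MvPolynomial.map (algebraMap C M))) (y := y') (by rw [hpM, h0, map_zero])
    (by rw [Polynomial.derivative_map, hpM]; exact (map_ne_zero _).mpr h1)
  have hfix : ∀ (τ : Ω ≃ₐ[F] Ω) n m,
      τ (algebraMap M Ω ((g.coeff n).coeff m)) = algebraMap M Ω ((g.coeff n).coeff m) := by
    intro τ n m
    let τC : Ω →ₐ[C] Ω := (τ : Ω →ₐ[F] Ω).restrictScalars C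
    let τM : M →ₐ[C] M := τC.restrictNormal M
    have hτM : ∀ c, algebraMap M Ω (τM c) = τ (algebraMap M Ω c) :=
      AlgHom.restrictNormal_commutes τC M
    let Φ : MvPolynomial σ M →+* MvPolynomial σ M := MvPolynomial.map (τM : M →+* M)
    have hev : ∀ q : Polynomial (MvPolynomial σ M),
        evalMvPoly t' y' (q.map Φ) = τ (evalMvPoly t' y' q) := by
      have : (evalMvPoly t' y').comp (Polynomial.mapRingHom Φ) =
          ((τ : Ω →ₐ[F] Ω) : Ω →+* Ω).comp (evalMvPoly (k := M) t' y') := by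
        refine Polynomial.ringHom_ext' (MvPolynomial.ringHom_ext ?_ ?_) ?_
        · intro c
          simp [evalMvPoly, Φ, hτM]
        · simp [evalMvPoly, Φ, t']
        · simp [evalMvPoly, y']
      exact fun q => RingHom.congr_fun this q
    have hgΦ : (g.map Φ).Monic := hg.map _
    have hsub : g.map Φ - g = 0 := by
      have hinj : Function.Injective (MvPolynomial.map (σ := σ) (algebraMap M k)) :=
        MvPolynomial.map_injective _ (algebraMap M k).injective
      by_contra hne
      refine hne ((Polynomial.map_eq_zero_iff hinj).mp (hmin _ ?_ ?_))
      · refine Polynomial.natDegree_map_le.trans_lt ?_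
        refine (Polynomial.natDegree_lt_natDegree hne
          (Polynomial.degree_sub_lt_left ?_ hgΦ.ne_zero ?_)).trans_le (hg.natDegree_map Φ).le
        · rw [Polynomial.degree_eq_natDegree hg.ne_zero,
            Polynomial.degree_eq_natDegree hgΦ.ne_zero, hg.natDegree_map]
        · rw [hg.leadingCoeff, hgΦ.leadingCoeff]
      · rw [evalMvPoly_map, map_sub, hev, hg0, map_zero, sub_zero]
    have hcoeff := congrArg (fun q => (q.coeff n).coeff m) (sub_eq_zero.mp hsub)
    simp only [Polynomial.coeff_map, Φ, MvPolynomial.coeff_map] at hcoeff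
    rw [← hτM]
    exact congrArg _ hcoeff
  have hsepM : ∀ c : M, IsSeparable C (algebraMap M Ω c) := fun c =>
    (Algebra.IsSeparable.isSeparable C c).map (IsScalarTower.toAlgHom C M Ω) (algebraMap M Ω).injective
  have hX : ∀ n m, ∃ x : F, algebraMap F Ω x = algebraMap M Ω ((g.coeff n).coeff m) :=
    fun n m => mem_range_of_isSeparable_of_forall_algEquiv
      ((hsepM _).tower_top F) fun τ => hfix τ n m
  choose X hX using hX
  let S : Finset F := g.support.biUnion fun n => (g.coeff n).support.image (X n)
  have hSsep : ∀ x ∈ S, IsSeparable C x := by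
    intro x hx
    simp only [S, Finset.mem_biUnion, Finset.mem_image] at hx
    obtain ⟨n, -, m, -, rfl⟩ := hx
    have := hsepM ((g.coeff n).coeff m)
    rw [← hX] at this
    exact this.of_algHom (IsScalarTower.toAlgHom C F Ω)
  let L : IntermediateField C F := IntermediateField.adjoin C S
  have hXL : ∀ n m, X n m ∈ L := by
    intro n m
    by_cases h : (g.coeff n).coeff m = 0
    · have h2 := hX n m
      rw [h, map_zero, map_eq_zero] at h2
      rw [h2]
      exact zero_mem _
    · refine IntermediateField.subset_adjoin C _ ?_
      simp only [S, Finset.coe_biUnion, Set.mem_iUnion, Finset.coe_image]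
      refine ⟨n, ?_, m, MvPolynomial.mem_support_iff.mpr h, rfl⟩
      rw [Finset.mem_coe, Polynomial.mem_support_iff]
      intro h0
      simp [h0] at h
  have hLfin : Module.Finite C L :=
    IntermediateField.finiteDimensional_adjoin fun x hx => (hSsep x hx).isIntegral
  have hLsep : Algebra.IsSeparable C L :=
    (IntermediateField.isSeparable_adjoin_iff_isSeparable C F).mpr hSsep
  have hLk : ∀ x : L, ∃ z : k, algebraMap k Ω z = algebraMap F Ω x := by
    intro x
    have hx : IsIntegral k (algebraMap F Ω x) :=
      ((Algebra.IsIntegral.isIntegral (R := C) x).map (IsScalarTower.toAlgHom C L Ω)).tower_top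
    exact minpoly.mem_range_of_degree_eq_one k _
      (IsAlgClosed.degree_eq_one_of_irreducible k (minpoly.irreducible hx))
  choose Z hZ using hLk
  have hinjk : Function.Injective (algebraMap k Ω) := (algebraMap k Ω).injective
  let j : L →+* k :=
    { toFun := Z
      map_one' := hinjk (by simp [hZ])
      map_mul' := fun a b => hinjk (by simp [hZ])
      map_zero' := hinjk (by simp [hZ])
      map_add' := fun a b => hinjk (by simp [hZ]) }
  let : Algebra L k := j.toAlgebra
  have hLkΩ : IsScalarTower L k Ω := .of_algebraMap_eq fun x => (hZ x).symm
  have hCLk : IsScalarTower C L k := .of_algebraMap_eq fun c => hinjk (by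
    rw [← IsScalarTower.algebraMap_apply C k Ω]
    refine Eq.trans ?_ (hZ _).symm
    rw [IsScalarTower.algebraMap_apply C F Ω]
    rfl)
  obtain ⟨f, hfg, hfd, hf⟩ := Polynomial.lifts_and_natDegree_eq_and_monic
    (f := MvPolynomial.map (σ := σ) (algebraMap L Ω))
    (p := g.map (MvPolynomial.map (algebraMap M Ω))) (by
      rw [Polynomial.lifts_iff_coeff_lifts]
      intro n
      rw [MvPolynomial.mem_range_map_iff_coeffs_subset]
      intro c hc
      obtain ⟨m, hm, rfl⟩ := MvPolynomial.mem_coeffs_iff.mp hc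
      refine ⟨⟨X n m, hXL n m⟩, ?_⟩
      rw [Polynomial.coeff_map, MvPolynomial.coeff_map]
      exact hX n m) (hg.map _)
  have hfΩ : ∀ (f : Polynomial (MvPolynomial σ L)) (g : Polynomial (MvPolynomial σ M)),
      f.map (MvPolynomial.map (algebraMap L Ω)) = g.map (MvPolynomial.map (algebraMap M Ω)) →
      algebraMap F Ω (evalMvPoly t y f) = evalMvPoly t' y' g := by
    intro f g h
    rw [← evalMvPoly_map (k := Ω) t' y' g, ← h, evalMvPoly_map]
    exact map_evalMvPoly (IsScalarTower.toAlgHom L F Ω) t y f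
  refine ⟨L, inferInstance, hLfin, hLsep, hCLk, hLkΩ, f, hf, ?_, ?_, ?_⟩
  · rw [← map_eq_zero (algebraMap F Ω), hfΩ f g hfg, hg0]
  · rw [← map_ne_zero (algebraMap F Ω), hfΩ _ g.derivative, ]
    · exact hg1
    · rw [← Polynomial.derivative_map, ← Polynomial.derivative_map, hfg]
  · rwa [hfd, hg.natDegree_map]

end Descent

section Generators

theorem mem_range_evalMvPoly_of_mem_adjoin {σ C S : Type*} [CommRing C] [CommRing S] [Algebra C S]
    (t : σ → S) (y : S) {x : S} (hx : x ∈ Algebra.adjoin C (Set.range t ∪ {y})) :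
    ∃ q : Polynomial (MvPolynomial σ C), evalMvPoly t y q = x := by
  induction hx using Algebra.adjoin_induction with
  | mem x hx =>
    obtain ⟨i, rfl⟩ | rfl := hx
    · exact ⟨.C (.X i), by simp [evalMvPoly]⟩
    · exact ⟨.X, by simp [evalMvPoly]⟩
  | algebraMap c => exact ⟨.C (.C c), by simp [evalMvPoly]⟩
  | add x y _ _ hx hy =>
    obtain ⟨p, rfl⟩ := hx
    obtain ⟨q, rfl⟩ := hy
    exact ⟨p + q, map_add _ _ _⟩
  | mul x y _ _ hx hy =>
    obtain ⟨p, rfl⟩ := hx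
    obtain ⟨q, rfl⟩ := hy
    exact ⟨p * q, map_mul _ _ _⟩

open IntermediateField.algebraAdjoinAdjoin in
/-- A finitely generated subextension of a separable extension is generated by algebraically
independent elements `t` and a single integral separable element `y` over them. -/
theorem exists_algebraicIndependent_and_monic {C F : Type} [Field C] [Field F]
    [Algebra C F] [IsReduced (F ⊗[C] AlgebraicClosure C)] {ι : Type*} [Finite ι] (a : ι → F) :
    ∃ (σ : Type) (_ : Finite σ) (t : σ → F) (y : F) (p : Polynomial (MvPolynomial σ C)),
      AlgebraicIndependent C t ∧ p.Monic ∧ evalMvPoly t y p = 0 ∧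
      evalMvPoly t y p.derivative ≠ 0 ∧
      ∀ i, ∃ q r : Polynomial (MvPolynomial σ C), evalMvPoly t y r ≠ 0 ∧
        a i * evalMvPoly t y r = evalMvPoly t y q := by
  classical
  let E : IntermediateField C F := IntermediateField.adjoin C (Set.range a)
  have hEfg : E.FG := IntermediateField.fg_adjoin_of_finite (Set.finite_range a)
  have hE : Algebra.EssFiniteType C E := IntermediateField.essFiniteType_iff.mpr hEfg
  obtain ⟨s, hs, hsep⟩ := exists_isTranscendenceBasis_and_isSeparable_adjoin E
  let t : s → E := (↑)
  have ht : Set.range t = s := Subtype.range_coe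
  rw [← ht] at hsep
  set K := IntermediateField.adjoin C (Set.range t)
  set B := Algebra.adjoin C (Set.range t)
  have hKE : Algebra.EssFiniteType K E := .of_comp C K E
  have hfin : Module.Finite K E := Algebra.finite_of_essFiniteType_of_isAlgebraic
  obtain ⟨α, hα⟩ := Field.exists_primitive_element K E
  have hBK : IsFractionRing B K := inferInstance
  have hαB : IsAlgebraic B α :=
    (IsFractionRing.isAlgebraic_iff B K E).mpr (Algebra.IsAlgebraic.isAlgebraic α)
  obtain ⟨b, hb, hint⟩ := hαB.exists_integral_multiple
  set y : E := b • α
  have hy : IntermediateField.adjoin K {y} = ⊤ := by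
    rw [eq_top_iff, ← hα, IntermediateField.adjoin_simple_le_iff]
    have hb' : algebraMap B K b ≠ 0 := by
      simpa using hb
    have : α = (algebraMap B K b)⁻¹ • y := by
      rw [eq_inv_smul_iff₀ hb', algebraMap_smul]
    rw [this]
    exact IntermediateField.smul_mem _ (IntermediateField.mem_adjoin_simple_self K y)
  have hy' : IntermediateField.adjoin C (Set.range t ∪ {y}) = ⊤ := by
    rw [← IntermediateField.adjoin_adjoin_left, hy, IntermediateField.restrictScalars_top]
  obtain ⟨p, hp, hp0, hp1, -⟩ := exists_monic_evalMvPoly_eq_zero hs.1 hint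
    (Algebra.IsSeparable.isSeparable K y)
  have hev : ∀ p : Polynomial (MvPolynomial s C),
      evalMvPoly (E.val ∘ t) (E.val y) p = E.val (evalMvPoly t y p) :=
    fun p => (map_evalMvPoly E.val t y p).symm
  refine ⟨s, inferInstance, E.val ∘ t, E.val y, p, hs.1.map' E.val.injective, hp, ?_, ?_, ?_⟩
  · rw [hev, hp0, map_zero]
  · rw [hev]
    exact (map_ne_zero _).mpr hp1
  · intro i
    let e : E := ⟨a i, IntermediateField.subset_adjoin C _ ⟨i, rfl⟩⟩
    have he : e ∈ IntermediateField.adjoin C (Set.range t ∪ {y}) := hy' ▸ trivial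
    obtain ⟨u, hu, v, hv, huv⟩ := IntermediateField.mem_adjoin_iff_div.mp he
    obtain ⟨q, rfl⟩ := mem_range_evalMvPoly_of_mem_adjoin t y hu
    obtain ⟨r, rfl⟩ := mem_range_evalMvPoly_of_mem_adjoin t y hv
    by_cases h0 : evalMvPoly t y r = 0
    · rw [h0, div_zero] at huv
      refine ⟨0, 1, by simp, ?_⟩
      rw [show a i = E.val e from rfl, huv]
      simp
    · refine ⟨q, r, ?_, ?_⟩
      · rw [hev]
        exact (map_ne_zero _).mpr h0
      · rw [hev, hev, show a i = E.val e from rfl, ← map_mul, huv, div_mul_cancel₀ _ h0]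

end Generators

section Model

theorem exists_standardEtalePresentation {C F : Type} [Field C] [Field F]
    [Algebra C F] [IsReduced (F ⊗[C] AlgebraicClosure C)] {ι : Type*} [Finite ι] (a : ι → F) :
    ∃ (L : IntermediateField C F) (_ : Algebra L (AlgebraicClosure C)),
      Module.Finite C L ∧ Algebra.IsSeparable C L ∧ IsScalarTower C L (AlgebraicClosure C) ∧
      ∃ (σ : Type) (_ : Finite σ) (A : Type) (_ : CommRing A) (_ : Algebra L A)
        (_ : Algebra (MvPolynomial σ L) A) (_ : IsScalarTower L (MvPolynomial σ L) A)
        (_ : StandardEtalePresentation (MvPolynomial σ L) A) (j : A →ₐ[L] F),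
        (∀ i, a i ∈ j.range) ∧ Function.Injective j ∧ IsDomain (AlgebraicClosure C ⊗[L] A) := by
  obtain ⟨σ, _, t, y, p, ht, hp, hp0, hp1, hqr⟩ := exists_algebraicIndependent_and_monic (C := C) a
  choose q r hr hqr using hqr
  cases nonempty_fintype ι
  let k := AlgebraicClosure C
  let Ω := AlgebraicClosure F
  let : Algebra k Ω := (IsAlgClosed.lift : k →ₐ[C] Ω).toRingHom.toAlgebra
  have : IsScalarTower C k Ω := .of_algebraMap_eq fun c =>
    ((IsAlgClosed.lift : k →ₐ[C] Ω).commutes c).symm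
  obtain ⟨L, _, hLfin, hLsep, hCLk, hLkΩ, f, hf, hf0, hf1, hmin⟩ :=
    exists_finite_separable_monic_minimal (M := separableClosure C k) (k := k) (Ω := Ω) ht hp hp0 hp1
  let R := MvPolynomial σ L
  let ρ : Polynomial (MvPolynomial σ C) →+* Polynomial R :=
    Polynomial.mapRingHom (MvPolynomial.map (algebraMap C L))
  let P : StandardEtalePair R :=
    { f := f
      monic_f := hf
      g := f.derivative * ∏ i, ρ (r i)
      cond := ⟨∏ i, ρ (r i), 0, 1, by simp⟩ }
  let A := P.Ring
  let : Algebra L A := ((algebraMap R A).comp (algebraMap L R)).toAlgebra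
  have : IsScalarTower L R A := .of_algebraMap_eq fun _ => rfl
  let Q : StandardEtalePresentation R A :=
    { P with
      x := P.X
      hasMap := P.hasMap_X
      lift_bijective := by
        rw [P.lift_X_left]
        exact Function.bijective_id }
  let : Algebra R F := (MvPolynomial.aeval t : R →ₐ[L] F).toRingHom.toAlgebra
  have : IsScalarTower L R F := .of_algebraMap_eq fun c =>
    ((MvPolynomial.aeval t : R →ₐ[L] F).commutes c).symm
  have htX : (fun i => algebraMap R F (.X i)) = t := by
    ext i
    exact MvPolynomial.aeval_X _ _
  have hev : ∀ q : Polynomial R, Polynomial.aeval y q = evalMvPoly t y q := by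
    intro q
    rw [aeval_eq_evalMvPoly, htX]
  have hρ : ∀ q, Polynomial.aeval y (ρ q) = evalMvPoly t y q := by
    intro q
    rw [hev]
    exact evalMvPoly_map t y q
  have hmap : P.HasMap y := by
    refine ⟨(hev f).trans hf0, isUnit_iff_ne_zero.mpr ?_⟩
    rw [map_mul, map_prod, hev]
    refine mul_ne_zero hf1 (Finset.prod_ne_zero_iff.mpr fun i _ => ?_)
    rw [hρ]
    exact hr i
  let j₀ : A →ₐ[R] F := P.lift y hmap
  have hj₀ : j₀ P.X = y := P.lift_X y hmap
  let j : A →ₐ[L] F := j₀.restrictScalars L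
  have hjX : ∀ i, j (algebraMap R A (.X i)) = t i := fun i =>
    (j₀.commutes _).trans (congrFun htX i)
  let jΩ : A →ₐ[L] Ω := (IsScalarTower.toAlgHom L F Ω).comp j
  have hinj := Q.productMap_injective (k := k) jΩ (by
    intro q hq hq0
    refine hmin q hq ?_
    rw [← hq0]
    congr 2
    · ext i
      exact congrArg (algebraMap F Ω) (hjX i).symm
    · exact congrArg (algebraMap F Ω) hj₀.symm)
  refine ⟨L, inferInstance, hLfin, hLsep, hCLk, σ, inferInstance, A, inferInstance, inferInstance,
    inferInstance, inferInstance, Q, j, ?_, ?_, ?_⟩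
  · intro i
    have hunit : IsUnit (Polynomial.aeval P.X (ρ (r i))) := by
      have h := P.hasMap_X.2
      rw [map_mul, map_prod] at h
      have h' := isUnit_of_mul_isUnit_right h
      exact isUnit_of_dvd_unit
        (Finset.dvd_prod_of_mem (fun i => Polynomial.aeval P.X (ρ (r i))) (Finset.mem_univ i)) h'
    have hj : ∀ q, j (Polynomial.aeval P.X (ρ q)) = evalMvPoly t y q := by
      intro q
      rw [← hρ, ← hj₀]
      exact (Polynomial.aeval_algHom_apply j₀ P.X _).symm
    obtain ⟨u, hu⟩ := hunit.exists_left_inv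
    refine ⟨Polynomial.aeval P.X (ρ (q i)) * u, ?_⟩
    change j _ = _
    refine mul_right_cancel₀ (hr i) ?_
    rw [hqr, ← hj, ← hj, ← map_mul, mul_assoc, hu, mul_one]
  · have : Function.Injective jΩ := by
      intro x y hxy
      have h : (1 : k) ⊗ₜ[L] x = 1 ⊗ₜ[L] y := hinj (by simpa using hxy)
      exact Algebra.TensorProduct.includeRight_injective (algebraMap L k).injective h
    exact Function.Injective.of_comp (f := algebraMap F Ω) this
  · exact hinj.isDomain (Algebra.TensorProduct.lift (Algebra.ofId k Ω) jΩ
      fun _ _ => .all _ _).toRingHom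

theorem StandardEtalePresentation.smooth {σ L A : Type*} [Finite σ] [Field L] [CommRing A]
    [Algebra L A] [Algebra (MvPolynomial σ L) A] [IsScalarTower L (MvPolynomial σ L) A]
    (P : StandardEtalePresentation (MvPolynomial σ L) A) : Algebra.Smooth L A := by
  have : Algebra.IsStandardEtale (MvPolynomial σ L) A := ⟨⟨P⟩⟩
  have : Algebra.Smooth L (MvPolynomial σ L) := ⟨inferInstance, inferInstance⟩
  exact .comp L (MvPolynomial σ L) A

/-- Hensel's lemma for standard smooth algebras. -/
theorem StandardEtalePresentation.exists_algHom_of_henselianLocalRing {σ L A : Type*} {O K : Type}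
    [CommRing L] [CommRing A] [Algebra L A] [Algebra (MvPolynomial σ L) A]
    [IsScalarTower L (MvPolynomial σ L) A] (P : StandardEtalePresentation (MvPolynomial σ L) A)
    [CommRing O] [HenselianLocalRing O] [Algebra L O] [Field K] [Algebra L K] (π : O →ₐ[L] K)
    (hπ : Function.Surjective π) (φ : A →ₐ[L] K) : Nonempty (A →ₐ[L] O) := by
  let R := MvPolynomial σ L
  choose t ht using fun i => hπ (φ (algebraMap R A (.X i)))
  let : Algebra R O := (MvPolynomial.aeval t : R →ₐ[L] O).toRingHom.toAlgebra
  have : IsScalarTower L R O := .of_algebraMap_eq fun c =>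
    ((MvPolynomial.aeval t : R →ₐ[L] O).commutes c).symm
  have hR : (π : O →+* K).comp (algebraMap R O) = (φ : A →+* K).comp (algebraMap R A) := by
    refine MvPolynomial.ringHom_ext (fun l => ?_) fun i => ?_
    · change π (algebraMap R O (algebraMap L R l)) = φ (algebraMap R A (algebraMap L R l))
      simp only [← IsScalarTower.algebraMap_apply, AlgHom.commutes]
    · change π (MvPolynomial.aeval t (.X i : R)) = φ (algebraMap R A (.X i))
      rw [MvPolynomial.aeval_X, ht]
  let : Algebra R K := ((φ : A →+* K).comp (algebraMap R A)).toAlgebra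
  let φ' : A →ₐ[R] K := { φ with commutes' := fun _ => rfl }
  let π' : O →ₐ[R] K := { π with commutes' := fun x => RingHom.congr_fun hR x }
  have hmap : P.HasMap (φ' P.x) := P.hasMap.map φ'
  have hev : ∀ p : Polynomial R,
      (p.map (algebraMap R O)).eval₂ (π : O →+* K) (φ' P.x) = Polynomial.aeval (φ' P.x) p := by
    intro p
    rw [Polynomial.eval₂_map, Polynomial.aeval_def, hR]
    rfl
  have htfae := (HenselianLocalRing.TFAE O).out 0 2
  obtain ⟨y, hy, hyx⟩ := htfae.mp ‹HenselianLocalRing O› (π : O →+* K) hπ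
    (P.f.map (algebraMap R O)) (P.monic_f.map _) (φ' P.x) (by rw [hev, hmap.1])
    (by rw [Polynomial.derivative_map, hev]; exact hmap.isUnit_derivative_f.ne_zero)
  have hy' : P.HasMap y := by
    refine ⟨by rwa [Polynomial.IsRoot, Polynomial.eval_map_algebraMap] at hy, ?_⟩
    have : IsLocalHom (π : O →+* K) := IsLocalHom.of_surjective _ hπ
    refine isUnit_of_map_unit (π : O →+* K) _ ?_
    have h : π' (Polynomial.aeval y P.g) = Polynomial.aeval (φ' P.x) P.g := by
      rw [← Polynomial.aeval_algHom_apply]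
      exact congrArg (fun z => Polynomial.aeval z P.g) hyx
    exact h ▸ hmap.2
  let ψ : A →ₐ[R] O := (P.lift y hy').comp P.equivRing.toAlgHom
  exact ⟨ψ.restrictScalars L⟩

end Model

section Specialization

/-- Any algebra homomorphism from a finite separable extension to the residue field of a henselian
local ring, given by a root of a minimal polynomial, lifts. -/
theorem exists_algHom_of_isSeparable_of_henselianLocalRing {C L O : Type} [Field C] [Field L]
    [Algebra C L] [Module.Finite C L] [Algebra.IsSeparable C L] [CommRing O] [HenselianLocalRing O]
    [Algebra C O]
    (hroot : ∀ x : L, ∃ z : IsLocalRing.ResidueField O, Polynomial.aeval z (minpoly C x) = 0) :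
    Nonempty (L →ₐ[C] O) := by
  let pb := Field.powerBasisOfFiniteOfSeparable C L
  obtain ⟨z, hz⟩ := hroot pb.gen
  have hsep : (minpoly C pb.gen).Separable := Algebra.IsSeparable.isSeparable C pb.gen
  have htfae := (HenselianLocalRing.TFAE O).out 0 1
  obtain ⟨y, hy, -⟩ := htfae.mp ‹HenselianLocalRing O›
    ((minpoly C pb.gen).map (algebraMap C O)) ((minpoly.monic pb.isIntegral_gen).map _) z
    (by rw [Polynomial.aeval_map_algebraMap, hz])
    (by
      rw [Polynomial.derivative_map, Polynomial.aeval_map_algebraMap]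
      exact hsep.aeval_derivative_ne_zero hz)
  exact ⟨pb.lift y (by rwa [Polynomial.IsRoot, Polynomial.eval_map_algebraMap] at hy)⟩

/-- Specialization of a finite tuple of a separable extension `F` of `C` to a henselian local ring
whose residue field has points on geometrically integral smooth `C`-algebras. -/
theorem exists_specialization_of_henselianLocalRing {C F O : Type} [Field C] [Field F]
    [Algebra C F] [IsReduced (F ⊗[C] AlgebraicClosure C)] [CommRing O] [HenselianLocalRing O]
    [Algebra C O]
    (hpts : ∀ (A : Type) [CommRing A] [Algebra C A], Algebra.Smooth C A →
      IsDomain (AlgebraicClosure C ⊗[C] A) → Nonempty (A →ₐ[C] IsLocalRing.ResidueField O))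
    (hroot : ∀ x : F, IsIntegral C x →
      ∃ z : IsLocalRing.ResidueField O, Polynomial.aeval z (minpoly C x) = 0)
    {ι : Type*} [Finite ι] (a : ι → F) :
    ∃ b : ι → O, ∀ p : MvPolynomial ι C, MvPolynomial.aeval a p = 0 → MvPolynomial.aeval b p = 0 := by
  obtain ⟨L, _, hLfin, hLsep, hCLk, σ, _, A, _, _, _, _, P, j, haj, hj, hdom⟩ :=
    exists_standardEtalePresentation (C := C) a
  obtain ⟨s⟩ : Nonempty (L →ₐ[C] O) := by
    refine exists_algHom_of_isSeparable_of_henselianLocalRing fun x => ?_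
    obtain ⟨z, hz⟩ := hroot x ((Algebra.IsIntegral.isIntegral (R := C) x).map L.val)
    exact ⟨z, by rwa [← minpoly.algebraMap_eq (algebraMap L F).injective x]⟩
  let : Algebra L O := s.toRingHom.toAlgebra
  have : IsScalarTower C L O := .of_algebraMap_eq fun c => (s.commutes c).symm
  have : IsScalarTower C L (IsLocalRing.ResidueField O) := .of_algebraMap_eq fun c => by
    rw [IsScalarTower.algebraMap_apply C O, IsScalarTower.algebraMap_apply L O,
      IsScalarTower.algebraMap_apply C L O]
  have hA : Algebra.Smooth L A := P.smooth
  have : Algebra.FiniteType L A := inferInstance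
  obtain ⟨R, _, _, u, hRfin, hR⟩ := exists_isWeilRestriction C L A
  have : Algebra.FormallySmooth C R := hR.formallySmooth
  have : Algebra.FinitePresentation C R := Algebra.FinitePresentation.of_finiteType.mp hRfin
  obtain ⟨ρ⟩ := hpts R ⟨inferInstance, inferInstance⟩ (hR.isDomain (k := AlgebraicClosure C))
  let φ : A →ₐ[L] IsLocalRing.ResidueField O :=
    (Algebra.TensorProduct.lift (Algebra.ofId L _) ρ fun _ _ => .all _ _).comp u
  obtain ⟨ψ⟩ := P.exists_algHom_of_henselianLocalRing
    (IsScalarTower.toAlgHom L O (IsLocalRing.ResidueField O)) IsLocalRing.residue_surjective φ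
  let : Algebra C A := ((algebraMap L A).comp (algebraMap C L)).toAlgebra
  have : IsScalarTower C L A := .of_algebraMap_eq fun _ => rfl
  choose c hc using haj
  refine ⟨fun i => ψ (c i), fun p hp => ?_⟩
  have hcomp : ∀ {S : Type} [CommRing S] [Algebra C S] (χ : A →ₐ[C] S),
      MvPolynomial.aeval (fun i => χ (c i)) p = χ (MvPolynomial.aeval c p) := fun χ =>
    DFunLike.congr_fun (MvPolynomial.comp_aeval c χ).symm p
  have h0 : MvPolynomial.aeval c p = 0 := by
    refine hj ?_
    rw [map_zero, ← hp]
    refine (hcomp (j.restrictScalars C)).symm.trans ?_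
    exact congrArg (fun a => MvPolynomial.aeval a p) (funext hc)
  refine (hcomp (ψ.restrictScalars C)).trans ?_
  rw [h0, map_zero]

end Specialization

section RingTerms

/-- Realization of a term of the language of rings with constants from `C`. -/
noncomputable def termEval {C F : Type} [Field F] (ι : C → F) {n : ℕ} (a : Fin n → F)
    (t : (Language.ring[[C]]).Term (Empty ⊕ Fin n)) : F :=
  letI := ringCStructure C F ι
  t.realize (Sum.elim default a)

theorem exists_mvPolynomial_of_term {C : Type} [Field C] {n : ℕ}
    (t : (Language.ring[[C]]).Term (Empty ⊕ Fin n)) :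
    ∃ p : MvPolynomial (Fin n) C, ∀ (F : Type) [Field F] (ι : C →+* F) (a : Fin n → F),
      termEval ι a t = MvPolynomial.eval₂ ι a p := by
  induction t with
  | var x =>
    obtain x | i := x
    · exact x.elim
    · exact ⟨.X i, fun F _ ι a => by rw [MvPolynomial.eval₂_X]; rfl⟩
  | func f ts ih =>
    choose p hp using ih
    obtain f | c := f
    · cases f with
      | add => exact ⟨p 0 + p 1, fun F _ ι a => by
          rw [MvPolynomial.eval₂_add, ← hp, ← hp]; rfl⟩
      | mul => exact ⟨p 0 * p 1, fun F _ ι a => by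
          rw [MvPolynomial.eval₂_mul, ← hp, ← hp]; rfl⟩
      | neg => exact ⟨-p 0, fun F _ ι a => by
          rw [← MvPolynomial.coe_eval₂Hom, map_neg, MvPolynomial.coe_eval₂Hom, ← hp]; rfl⟩
      | zero => exact ⟨0, fun F _ ι a => by rw [MvPolynomial.eval₂_zero]; rfl⟩
      | one => exact ⟨1, fun F _ ι a => by rw [MvPolynomial.eval₂_one]; rfl⟩
    · rename_i l
      cases l with
      | zero => exact ⟨.C c, fun F _ ι a => (MvPolynomial.eval₂_C ι a c).symm⟩
      | succ l => exact c.elim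

theorem exists_term_of_polynomial {C : Type} [Field C] (p : Polynomial C) :
    ∃ t : (Language.ring[[C]]).Term (Empty ⊕ Fin 1), ∀ (F : Type) [Field F] (ι : C →+* F)
      (a : Fin 1 → F), termEval ι a t = p.eval₂ ι (a 0) := by
  let addTerm (t₁ t₂ : (Language.ring[[C]]).Term (Empty ⊕ Fin 1)) :
      (Language.ring[[C]]).Term (Empty ⊕ Fin 1) :=
    .func (l := 2) (Sum.inl ringFunc.add) ![t₁, t₂]
  let mulTerm (t₁ t₂ : (Language.ring[[C]]).Term (Empty ⊕ Fin 1)) :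
      (Language.ring[[C]]).Term (Empty ⊕ Fin 1) :=
    .func (l := 2) (Sum.inl ringFunc.mul) ![t₁, t₂]
  have hadd : ∀ t₁ t₂ (F : Type) [Field F] (ι : C →+* F) (a : Fin 1 → F),
      termEval ι a (addTerm t₁ t₂) = termEval ι a t₁ + termEval ι a t₂ := fun _ _ _ _ _ _ => rfl
  have hmul : ∀ t₁ t₂ (F : Type) [Field F] (ι : C →+* F) (a : Fin 1 → F),
      termEval ι a (mulTerm t₁ t₂) = termEval ι a t₁ * termEval ι a t₂ := fun _ _ _ _ _ _ => rfl
  induction p using Polynomial.induction_on with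
  | C c =>
    refine ⟨.func (l := 0) (Sum.inr c) ![], fun F _ ι a => ?_⟩
    rw [Polynomial.eval₂_C]
    rfl
  | add p q hp hq =>
    obtain ⟨t₁, h₁⟩ := hp
    obtain ⟨t₂, h₂⟩ := hq
    exact ⟨addTerm t₁ t₂, fun F _ ι a => by rw [hadd, h₁, h₂, Polynomial.eval₂_add]⟩
  | monomial n c h =>
    obtain ⟨t, ht⟩ := h
    refine ⟨mulTerm t (.var (Sum.inr 0)), fun F _ ι a => ?_⟩
    rw [hmul, ht, pow_succ, ← mul_assoc, Polynomial.eval₂_mul_X]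
    rfl

end RingTerms

section QuantifierFree

/-- Realization of a formula of the language of rings with constants from `C`. -/
def formulaHolds {C F : Type} [Field F] (ι : C → F) {n : ℕ}
    (ψ : (Language.ring[[C]]).BoundedFormula Empty n) (a : Fin n → F) : Prop :=
  letI := ringCStructure C F ι
  ψ.Realize default a

theorem satRC_exs {C F : Type} [Field F] (ι : C → F) {n : ℕ}
    (ψ : (Language.ring[[C]]).BoundedFormula Empty n) :
    SatRC C F ι ψ.exs ↔ ∃ a, formulaHolds ι ψ a := by
  let := ringCStructure C F ι
  exact BoundedFormula.realize_exs

theorem satRC_alls {C F : Type} [Field F] (ι : C → F) {n : ℕ}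
    (ψ : (Language.ring[[C]]).BoundedFormula Empty n) :
    SatRC C F ι ψ.alls ↔ ∀ a, formulaHolds ι ψ a := by
  let := ringCStructure C F ι
  exact BoundedFormula.realize_alls

theorem satRC_alls_iff_not_exs {C F : Type} [Field F] (ι : C → F) {n : ℕ}
    (ψ : (Language.ring[[C]]).BoundedFormula Empty n) :
    SatRC C F ι ψ.alls ↔ ¬ SatRC C F ι ψ.not.exs := by
  let := ringCStructure C F ι
  rw [satRC_alls, satRC_exs, ← not_forall_not]
  simp [formulaHolds]

theorem satRC_inf {C F : Type} [Field F] (ι : C → F) (φ ψ : (Language.ring[[C]]).Sentence) :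
    SatRC C F ι (φ ⊓ ψ) ↔ SatRC C F ι φ ∧ SatRC C F ι ψ := by
  let := ringCStructure C F ι
  exact BoundedFormula.realize_inf

theorem satRC_sup {C F : Type} [Field F] (ι : C → F) (φ ψ : (Language.ring[[C]]).Sentence) :
    SatRC C F ι (φ ⊔ ψ) ↔ SatRC C F ι φ ∨ SatRC C F ι ψ := by
  let := ringCStructure C F ι
  exact BoundedFormula.realize_sup

theorem formulaHolds_bdEqual {C F : Type} [Field F] (ι : C → F) {n : ℕ}
    (t₁ t₂ : (Language.ring[[C]]).Term (Empty ⊕ Fin n)) (a : Fin n → F) :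
    formulaHolds ι (t₁.bdEqual t₂) a ↔ termEval ι a t₁ = termEval ι a t₂ := by
  let := ringCStructure C F ι
  exact BoundedFormula.realize_bdEqual t₁ t₂

/-- The truth of a quantifier-free formula is preserved by specializations on a basic open set. -/
theorem exists_mvPolynomial_formulaHolds_iff {C F : Type} [Field C] [Field F] (ι : C →+* F) {n : ℕ}
    (a : Fin n → F) {ψ : (Language.ring[[C]]).BoundedFormula Empty n} (hψ : ψ.IsQF) :
    ∃ h : MvPolynomial (Fin n) C, MvPolynomial.eval₂ ι a h ≠ 0 ∧
      ∀ (F' : Type) [Field F'] (ι' : C →+* F') (a' : Fin n → F'),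
        (∀ p, MvPolynomial.eval₂ ι a p = 0 → MvPolynomial.eval₂ ι' a' p = 0) →
        MvPolynomial.eval₂ ι' a' h ≠ 0 → (formulaHolds ι ψ a ↔ formulaHolds ι' ψ a') := by
  induction hψ with
  | falsum => exact ⟨1, by simp, fun F' _ ι' a' _ _ => Iff.rfl⟩
  | of_isAtomic hψ =>
    cases hψ with
    | equal t₁ t₂ =>
      obtain ⟨p, hp⟩ := exists_mvPolynomial_of_term t₁
      obtain ⟨q, hq⟩ := exists_mvPolynomial_of_term t₂
      have key : ∀ (F : Type) [Field F] (ι : C →+* F) (a : Fin n → F),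
          formulaHolds ι (t₁.bdEqual t₂) a ↔ MvPolynomial.eval₂ ι a (p - q) = 0 := by
        intro F _ ι a
        rw [formulaHolds_bdEqual, hp, hq, ← sub_eq_zero, MvPolynomial.eval₂_sub]
      by_cases h : MvPolynomial.eval₂ ι a (p - q) = 0
      · refine ⟨1, by simp, fun F' _ ι' a' hspec _ => ?_⟩
        rw [key, key]
        exact iff_of_true h (hspec _ h)
      · refine ⟨p - q, h, fun F' _ ι' a' _ h' => ?_⟩
        rw [key, key]
        exact iff_of_false h h'
    | rel R ts =>
      obtain R | R := R
      · exact isEmptyElim R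
      · exact isEmptyElim R
  | @imp φ₁ φ₂ _ _ h₁ h₂ =>
    obtain ⟨h, hh, H⟩ := h₁
    obtain ⟨g, hg, G⟩ := h₂
    refine ⟨h * g, by rw [MvPolynomial.eval₂_mul]; exact mul_ne_zero hh hg,
      fun F' _ ι' a' hspec hne => ?_⟩
    rw [MvPolynomial.eval₂_mul] at hne
    have key : ∀ {F : Type} [Field F] (ι : C → F) (a : Fin n → F), formulaHolds ι (φ₁.imp φ₂) a ↔
      (formulaHolds ι φ₁ a → formulaHolds ι φ₂ a) := fun _ _ => Iff.rfl
    rw [key, key, H F' ι' a' hspec (left_ne_zero_of_mul hne),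
      G F' ι' a' hspec (right_ne_zero_of_mul hne)]

end QuantifierFree

section Transfer

theorem resConstExt_eq_resRingHom {C F : Type} [Field C] [Field F] (O : ValuationSubring F)
    (ι : C →+* F) (h : ∀ c, ι c ∈ O) : resConstExt O ι = resRingHom O ι h :=
  funext fun c => dif_pos (h c)

/-- Algebraic elements of `F` have conjugates in every field satisfying the existential theory of
the residue field. -/
theorem exists_eval₂_minpoly_eq_zero {C F k : Type} [Field C] [Field F] [Field k]
    (O : ValuationSubring F) (ι : C →+* F) (h : ∀ c, ι c ∈ O) (j : C →+* k)
    (hres : ∀ φ : (Language.ring[[C]]).Sentence, IsExistentialSen φ →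
      SatRC C (ResF O) (resRingHom O ι h) φ → SatRC C k j φ)
    {p : Polynomial C} (hp : p.Monic) {x : F} (hx : p.eval₂ ι x = 0) :
    ∃ z : k, p.eval₂ j z = 0 := by
  have hxO : x ∈ O := by
    obtain ⟨y, hy⟩ := IsIntegrallyClosed.isIntegral_iff (R := O) (K := F) |>.mp
      ⟨p.map (ι.codRestrict O h), hp.map _, by rw [Polynomial.eval₂_map]; exact hx⟩
    exact hy ▸ y.2
  have hxr : p.eval₂ (resRingHom O ι h) (IsLocalRing.residue O ⟨x, hxO⟩) = 0 := by
    have h0 : p.eval₂ (ι.codRestrict O h) ⟨x, hxO⟩ = 0 := by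
      refine Subtype.val_injective ?_
      exact (Polynomial.hom_eval₂ p _ O.subtype _).trans hx
    rw [resRingHom, ← Polynomial.hom_eval₂, h0, map_zero]
  obtain ⟨t, ht⟩ := exists_term_of_polynomial p
  obtain ⟨t₀, ht₀⟩ := exists_term_of_polynomial (0 : Polynomial C)
  have key : ∀ (E : Type) [Field E] (i : C →+* E),
      SatRC C E i (t.bdEqual t₀).exs ↔ ∃ a : Fin 1 → E, p.eval₂ i (a 0) = 0 := fun E _ i => by
    simp only [satRC_exs, formulaHolds_bdEqual, ht, ht₀, Polynomial.eval₂_zero]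
  obtain ⟨a, ha⟩ := (key k j).mp <| hres _ ⟨1, _, (BoundedFormula.IsAtomic.equal _ _).isQF, rfl⟩ <|
    (key _ _).mpr ⟨fun _ => _, hxr⟩
  exact ⟨_, ha⟩

/-- Existential sentences transfer to a henselian valued field whose residue field satisfies enough
existential sentences. -/
theorem SatRC.of_henselianLocalRing {C F F' : Type} [Field C] [Field F] [Field F']
    (ι : C →+* F) (hsep : SeparableExt ι) (O' : ValuationSubring F') [HenselianLocalRing O']
    (ι' : C →+* F') (h' : ∀ c, ι' c ∈ O')
    (hpts : ∀ (A : Type) [CommRing A] [Algebra C A], Algebra.Smooth C A →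
      IsDomain (AlgebraicClosure C ⊗[C] A) →
      letI := (resRingHom O' ι' h').toAlgebra
      Nonempty (A →ₐ[C] ResF O'))
    (hroot : ∀ (p : Polynomial C) (x : F), p.Monic → p.eval₂ ι x = 0 →
      ∃ z : ResF O', p.eval₂ (resRingHom O' ι' h') z = 0)
    {φ : (Language.ring[[C]]).Sentence} (hφ : IsExistentialSen φ) (hF : SatRC C F ι φ) :
    SatRC C F' ι' φ := by
  obtain ⟨n, ψ, hψ, rfl⟩ := hφ
  obtain ⟨a, ha⟩ := (satRC_exs _ ψ).mp hF
  obtain ⟨h, hh, H⟩ := exists_mvPolynomial_formulaHolds_iff ι a hψ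
  let : Algebra C F := ι.toAlgebra
  let : Algebra C O' := (ι'.codRestrict O' h').toAlgebra
  have hred : IsReduced (F ⊗[C] AlgebraicClosure C) := by
    have halg : (algebraMap C (AlgebraicClosure C)).toAlgebra =
        (inferInstance : Algebra C (AlgebraicClosure C)) := Algebra.algebra_ext _ _ fun _ => rfl
    have := hsep (AlgebraicClosure C) inferInstance (algebraMap C _)
    rwa [halg] at this
  obtain ⟨b, hb⟩ := exists_specialization_of_henselianLocalRing (C := C) (F := F) (O := O')
    (fun A _ _ hA hdom => by
      obtain ⟨f⟩ := hpts A hA hdom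
      exact ⟨{ f with commutes' := fun c => f.commutes c }⟩)
    (fun x hx => hroot (minpoly C x) x (minpoly.monic hx) (minpoly.aeval C x))
    (fun o : Option (Fin n) => o.elim (MvPolynomial.eval₂ ι a h)⁻¹ a)
  let a' : Option (Fin n) → F' := fun o => b o
  have hspec : ∀ p : MvPolynomial (Option (Fin n)) C, MvPolynomial.eval₂ ι
      (fun o : Option (Fin n) => o.elim (MvPolynomial.eval₂ ι a h)⁻¹ a) p = 0 →
      MvPolynomial.eval₂ ι' a' p = 0 := fun p hp => by
    have := congrArg O'.subtype (hb p hp)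
    rwa [map_zero, MvPolynomial.aeval_def, MvPolynomial.hom_eval₂] at this
  refine (satRC_exs _ ψ).mpr ⟨a' ∘ some, (H F' ι' (a' ∘ some) (fun p hp => ?_) ?_).mp ha⟩
  · rw [← MvPolynomial.eval₂_rename]
    exact hspec _ (by rwa [MvPolynomial.eval₂_rename])
  · intro h0
    have h1 := hspec (.X none * MvPolynomial.rename some h - 1) (by
      rw [MvPolynomial.eval₂_sub, MvPolynomial.eval₂_mul, MvPolynomial.eval₂_X,
        MvPolynomial.eval₂_rename, MvPolynomial.eval₂_one]
      exact sub_eq_zero.mpr (inv_mul_cancel₀ hh))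
    rw [MvPolynomial.eval₂_sub, MvPolynomial.eval₂_mul, MvPolynomial.eval₂_rename, h0,
      MvPolynomial.eval₂_one, mul_zero, zero_sub, neg_eq_zero] at h1
    exact one_ne_zero h1

end Transfer

/-- Proposition 5.1: separable henselian nontrivially valued extensions
of a trivially valued field `C` of imperfect exponent at most `1`, whose residue fields
have the same universal/existential `𝔏_ring(C)`-theory and contain rational points of all
geometrically integral smooth affine `C`-varieties, have the same universal/existential
`𝔏_ring(C)`-theory. -/
theorem UE_ring_theory_eq_of_henselian (C : Type) [Field C] (himp : ImperfectExpLEOne C)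
    (F : Type) [Field F] (O : ValuationSubring F) (ι : C →+* F)
    (F' : Type) [Field F'] (O' : ValuationSubring F') (ι' : C →+* F')
    (hTriv : ∀ c, ι c ∈ O) (hTriv' : ∀ c, ι' c ∈ O')
    (hHens : HenselianLocalRing ↥O) (hHens' : HenselianLocalRing ↥O')
    (hNontriv : O ≠ ⊤) (hNontriv' : O' ≠ ⊤)
    (hsep : SeparableExt ι) (hsep' : SeparableExt ι')
    (hres : ∀ ψ : (Language.ring[[C]]).Sentence, IsUE ψ →
      (SatRC C (ResF O) (resConstExt O ⇑ι) ψ ↔ SatRC C (ResF O') (resConstExt O' ⇑ι') ψ))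
    (hpts : ∀ (A : Type) [CommRing A] [Algebra C A], Algebra.Smooth C A →
      IsDomain (TensorProduct C (AlgebraicClosure C) A) →
      (letI := (resRingHom O ι hTriv).toAlgebra
       Nonempty (A →ₐ[C] ResF O)) ∧
      (letI := (resRingHom O' ι' hTriv').toAlgebra
       Nonempty (A →ₐ[C] ResF O'))) :
    ∀ φ : (Language.ring[[C]]).Sentence, IsUE φ →
      (SatRC C F (⇑ι) φ ↔ SatRC C F' (⇑ι') φ) := by
  rw [resConstExt_eq_resRingHom O ι hTriv, resConstExt_eq_resRingHom O' ι' hTriv'] at hres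
  have hex : ∀ φ : (Language.ring[[C]]).Sentence, IsExistentialSen φ →
      (SatRC C F ι φ ↔ SatRC C F' ι' φ) := fun φ hφ =>
    ⟨SatRC.of_henselianLocalRing ι hsep O' ι' hTriv' (fun A _ _ hA hdom => (hpts A hA hdom).2)
      (fun p x hp hx => exists_eval₂_minpoly_eq_zero O ι hTriv _
        (fun φ hφ => (hres φ (.ex hφ)).mp) hp hx) hφ,
    SatRC.of_henselianLocalRing ι' hsep' O ι hTriv (fun A _ _ hA hdom => (hpts A hA hdom).1)
      (fun p x hp hx => exists_eval₂_minpoly_eq_zero O' ι' hTriv' _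
        (fun φ hφ => (hres φ (.ex hφ)).mpr) hp hx) hφ⟩
  intro φ hφ
  induction hφ with
  | ex hφ => exact hex _ hφ
  | all hφ =>
    obtain ⟨n, ψ, hψ, rfl⟩ := hφ
    rw [satRC_alls_iff_not_exs, satRC_alls_iff_not_exs, hex _ ⟨n, _, hψ.not, rfl⟩]
  | inf _ _ h₁ h₂ => rw [satRC_inf, satRC_inf, h₁, h₂]
  | sup _ _ h₁ h₂ => rw [satRC_sup, satRC_sup, h₁, h₂]
end

section
/- Let K be a global function field. Every valued field (L,w) satisfying the common 𝔏_val(K)-theory of almost all completions K̂_v, v ∈ ℙ_K, is a henselian nontrivially valued field which is a separable field extension of K, on which w is trivial on K, and whose residue field is pseudofinite. In particular, the 𝔏_val(K)-theory of almost all K̂_v contains the 𝔏_val(K)-theory of henselian nontrivially valued fields separable over the trivially valued field K with pseudofinite residue field. -/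
open FirstOrder Language

section Places

variable (k K : Type) [Field k] [Field K] [Algebra k K]

/-- The set `ℙ_K` of places of the function field `K/k`. -/
def Places : Type :=
  {O : ValuationSubring K // IsPlace (algebraMap k K) O}

variable {k K}

/-- Satisfaction of an `𝔏_val`-sentence in the completion `K̂_v` at a place `v ∈ ℙ_K`. -/
def SatCmpl (v : Places k K) (φ : Lval.Sentence) : Prop :=
  SatV (cmplO K v.1) φ

/-- Satisfaction of an `𝔏_val(K)`-sentence in the completion `K̂_v` at a place `v ∈ ℙ_K`,
the constants from `K` being interpreted via the canonical embedding `K → K̂_v`. -/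
def SatCmplC (v : Places k K) (φ : (Lval[[K]]).Sentence) : Prop :=
  SatVC K (⇑(cmplEmb K v.1)) (cmplO K v.1) φ

/-- Satisfaction of an `𝔏_ring`-sentence in the residue field `Kv` at a place `v ∈ ℙ_K`. -/
def SatRes (v : Places k K) (ψ : Language.ring.Sentence) : Prop :=
  SatR (ResF v.1) ψ

/-- Satisfaction of an `𝔏_ring(K)`-sentence in the residue field `Kv` at a place `v ∈ ℙ_K`,
the constants from `K` being interpreted via the residue map. -/
def SatResC (v : Places k K) (ψ : (Language.ring[[K]]).Sentence) : Prop :=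
  SatRC K (ResF v.1) (resConstExt v.1 id) ψ

end Places

/-- `(F, O)` is an equicharacteristic henselian nontrivially valued field. -/
def EqHensNontriv (F : Type) [Field F] (O : ValuationSubring F) : Prop :=
  HenselianLocalRing ↥O ∧ O ≠ ⊤ ∧ ringChar F = ringChar (ResF O)
/-- A field with an arbitrary distinguished subset and an arbitrary family of constants
indexed by `K`, regarded as a structure for the language of valued fields over `K`. -/
structure PreVF (K : Type) where
  /-- The underlying type. -/
  F : Type
  [field : Field F]
  /-- The interpretation of `𝒪`. -/
  O : Set F
  /-- The interpretation of the constants. -/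
  ι : K → F

namespace PreVF

variable {K : Type}

instance (M : PreVF K) : Field M.F := M.field

noncomputable instance toStructure (M : PreVF K) : (Lval[[K]]).Structure M.F :=
  letI := ringStructure M.F
  letI := LOStructure M.O
  letI : Lval.Structure M.F := Language.sumStructure _ _ M.F
  letI := constantsOn.structure M.ι
  Language.sumStructure _ _ M.F

/-- Satisfaction of a sentence in a `PreVF K`. -/
def Sat (M : PreVF K) (φ : (Lval[[K]]).Sentence) : Prop := M.F ⊨ φ

/-- The `K`-structure attached to a valued field with constants. -/
def ofVal {F : Type} [Field F] (O : ValuationSubring F) (ι : K → F) : PreVF K := ⟨F, O, ι⟩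

theorem satVC_iff {F : Type} [Field F] (O : ValuationSubring F) (ι : K → F)
    (φ : (Lval[[K]]).Sentence) : SatVC K ι O φ ↔ (ofVal O ι).Sat φ := Iff.rfl

variable {α β : Type}

/-- A family of functions on all `PreVF K` given by a term. -/
def IsTerm (f : ∀ M : PreVF K, (α → M.F) → M.F) : Prop :=
  ∃ t : (Lval[[K]]).Term α, ∀ M v, t.realize v = f M v

/-- A family of relations on all `PreVF K` given by a formula. -/
def IsDef (P : ∀ M : PreVF K, (α → M.F) → Prop) : Prop :=
  ∃ φ : (Lval[[K]]).Formula α, ∀ M v, φ.Realize v ↔ P M v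

/-- The embedding of the language of rings. -/
def ringHom (K : Type) : Language.ring →ᴸ Lval[[K]] :=
  (Lval.lhomWithConstants K).comp LHom.sumInl

theorem realize_ringHom_onTerm (M : PreVF K) (t : Language.ring.Term α) (v : α → M.F) :
    ((ringHom K).onTerm t).realize v =
      @Term.realize _ M.F (ringStructure M.F) _ v t := by
  induction t with
  | var => rfl
  | func f ts ih =>
    simp only [LHom.onTerm, Term.realize_func, ih]
    rfl

theorem IsTerm.of_ring (t : Language.ring.Term α) {f : ∀ M : PreVF K, (α → M.F) → M.F}
    (h : ∀ (M : PreVF K) v, @Term.realize _ M.F (ringStructure M.F) _ v t = f M v) : IsTerm f :=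
  ⟨(ringHom K).onTerm t, fun M v => (realize_ringHom_onTerm M t v).trans (h M v)⟩

theorem IsTerm.var (i : α) : IsTerm (fun (_ : PreVF K) v => v i) := ⟨Term.var i, fun _ _ => rfl⟩

theorem IsTerm.const (a : K) : IsTerm (fun (M : PreVF K) (_ : α → M.F) => M.ι a) :=
  ⟨(Lval.con a).term, fun M v => by
    rw [Term.realize_constants]; rfl⟩

theorem IsTerm.comp₂ (t : Language.ring.Term (Fin 2)) {f g : ∀ M : PreVF K, (α → M.F) → M.F}
    (hf : IsTerm f) (hg : IsTerm g) :
    IsTerm (fun M v => @Term.realize _ M.F (ringStructure M.F) _ ![f M v, g M v] t) := by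
  obtain ⟨s, hs⟩ := hf
  obtain ⟨r, hr⟩ := hg
  refine ⟨((ringHom K).onTerm t).subst ![s, r], fun M v => ?_⟩
  rw [Term.realize_subst, realize_ringHom_onTerm]
  congr 1
  ext i
  fin_cases i
  · exact hs M v
  · exact hr M v

theorem realize_ring_add (M : PreVF K) (x y : M.F) :
    @Term.realize _ M.F (ringStructure M.F) _ ![x, y] (Term.var 0 + Term.var 1) = x + y := by
  let := Ring.compatibleRingOfRing M.F
  exact Ring.realize_add _ _ _

theorem realize_ring_mul (M : PreVF K) (x y : M.F) :
    @Term.realize _ M.F (ringStructure M.F) _ ![x, y] (Term.var 0 * Term.var 1) = x * y := by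
  let := Ring.compatibleRingOfRing M.F
  exact Ring.realize_mul _ _ _

theorem IsTerm.add {f g : ∀ M : PreVF K, (α → M.F) → M.F} (hf : IsTerm f) (hg : IsTerm g) :
    IsTerm (fun M v => f M v + g M v) := by
  simpa only [realize_ring_add] using! IsTerm.comp₂ (Term.var 0 + Term.var 1) hf hg

theorem IsTerm.mul {f g : ∀ M : PreVF K, (α → M.F) → M.F} (hf : IsTerm f) (hg : IsTerm g) :
    IsTerm (fun M v => f M v * g M v) := by
  simpa only [realize_ring_mul] using! IsTerm.comp₂ (Term.var 0 * Term.var 1) hf hg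

theorem IsTerm.zero : IsTerm (fun (M : PreVF K) (_ : α → M.F) => 0) :=
  .of_ring 0 fun M v => by
    let := Ring.compatibleRingOfRing M.F
    exact Ring.realize_zero _

theorem IsTerm.one : IsTerm (fun (M : PreVF K) (_ : α → M.F) => 1) :=
  .of_ring 1 fun M v => by
    let := Ring.compatibleRingOfRing M.F
    exact Ring.realize_one _

theorem IsTerm.neg {f : ∀ M : PreVF K, (α → M.F) → M.F} (hf : IsTerm f) :
    IsTerm (fun M v => - f M v) := by
  have h (M : PreVF K) (x y : M.F) :
      @Term.realize _ M.F (ringStructure M.F) _ ![x, y] (- Term.var 0) = - x := by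
    let := Ring.compatibleRingOfRing M.F
    exact Ring.realize_neg _ _
  simpa only [h] using! IsTerm.comp₂ (- Term.var 0) hf hf

theorem IsTerm.sub {f g : ∀ M : PreVF K, (α → M.F) → M.F} (hf : IsTerm f) (hg : IsTerm g) :
    IsTerm (fun M v => f M v - g M v) := by
  simpa only [sub_eq_add_neg] using hf.add hg.neg

theorem IsTerm.natCast (n : ℕ) : IsTerm (fun (M : PreVF K) (_ : α → M.F) => (n : M.F)) := by
  induction n with
  | zero => simpa using IsTerm.zero
  | succ n ih => simpa using ih.add IsTerm.one

theorem IsTerm.pow {f : ∀ M : PreVF K, (α → M.F) → M.F} (hf : IsTerm f) (n : ℕ) :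
    IsTerm (fun M v => f M v ^ n) := by
  induction n with
  | zero => simpa using IsTerm.one
  | succ n ih => simpa [pow_succ] using ih.mul hf

theorem IsTerm.sum {σ : Type} (s : Finset σ) {f : σ → ∀ M : PreVF K, (α → M.F) → M.F}
    (hf : ∀ i ∈ s, IsTerm (f i)) : IsTerm (fun M v => ∑ i ∈ s, f i M v) := by
  classical
  induction s using Finset.induction_on with
  | empty => simpa using IsTerm.zero
  | insert a s ha ih =>
    simpa [Finset.sum_insert ha] using (hf a (by simp)).add (ih fun i hi => hf i (by simp [hi]))

theorem IsDef.eq {f g : ∀ M : PreVF K, (α → M.F) → M.F} (hf : IsTerm f) (hg : IsTerm g) :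
    IsDef (fun M v => f M v = g M v) := by
  obtain ⟨s, hs⟩ := hf
  obtain ⟨r, hr⟩ := hg
  exact ⟨s.equal r, fun M v => by rw [Formula.realize_equal, hs, hr]⟩

/-- The predicate `𝒪`. -/
def symO (K : Type) : (Lval[[K]]).Relations 1 := Sum.inl (Sum.inr PUnit.unit)

theorem IsDef.mem {f : ∀ M : PreVF K, (α → M.F) → M.F} (hf : IsTerm f) :
    IsDef (fun M v => f M v ∈ M.O) := by
  obtain ⟨s, hs⟩ := hf
  exact ⟨(symO K).formula₁ s, fun M v => by rw [Formula.realize_rel₁, hs]; rfl⟩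

variable {P Q : ∀ M : PreVF K, (α → M.F) → Prop}

theorem IsDef.not (hP : IsDef P) : IsDef (fun M v => ¬ P M v) := by
  obtain ⟨φ, h⟩ := hP
  exact ⟨∼φ, fun M v => by rw [Formula.realize_not, h]⟩

theorem IsDef.imp (hP : IsDef P) (hQ : IsDef Q) : IsDef (fun M v => P M v → Q M v) := by
  obtain ⟨φ, h⟩ := hP
  obtain ⟨ψ, h'⟩ := hQ
  exact ⟨φ.imp ψ, fun M v => by rw [Formula.realize_imp, h, h']⟩

theorem IsDef.and (hP : IsDef P) (hQ : IsDef Q) : IsDef (fun M v => P M v ∧ Q M v) := by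
  obtain ⟨φ, h⟩ := hP
  obtain ⟨ψ, h'⟩ := hQ
  exact ⟨φ ⊓ ψ, fun M v => by rw [Formula.realize_inf, h, h']⟩

theorem IsDef.or (hP : IsDef P) (hQ : IsDef Q) : IsDef (fun M v => P M v ∨ Q M v) := by
  obtain ⟨φ, h⟩ := hP
  obtain ⟨ψ, h'⟩ := hQ
  exact ⟨φ ⊔ ψ, fun M v => by rw [Formula.realize_sup, h, h']⟩

theorem IsDef.all [Finite β] {R : ∀ M : PreVF K, (α ⊕ β → M.F) → Prop} (hR : IsDef R) :
    IsDef (fun M v => ∀ w : β → M.F, R M (Sum.elim v w)) := by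
  obtain ⟨φ, h⟩ := hR
  exact ⟨φ.iAlls β, fun M v => by simp only [Formula.realize_iAlls, ← h]⟩

theorem IsDef.forall_mem {σ : Type} [Finite σ] {R : σ → ∀ M : PreVF K, (α → M.F) → Prop}
    (hR : ∀ i, IsDef (R i)) : IsDef (fun M v => ∀ i, R i M v) := by
  choose φ h using hR
  exact ⟨Formula.iInf φ, fun M v => by simp [Formula.realize_iInf, h]⟩

/-- A property of all `PreVF K` axiomatised by a single sentence. -/
def IsSen (P : PreVF K → Prop) : Prop :=
  ∃ φ : (Lval[[K]]).Sentence, ∀ M : PreVF K, M.Sat φ ↔ P M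

theorem IsDef.isSen {R : ∀ M : PreVF K, (Empty → M.F) → Prop} (hR : IsDef R) :
    IsSen (fun M => R M default) := by
  obtain ⟨φ, h⟩ := hR
  exact ⟨φ, fun M => h M default⟩

theorem IsDef.isSen_forall [Finite β] {R : ∀ M : PreVF K, (β → M.F) → Prop}
    (hR : IsDef R) : IsSen (fun M => ∀ w, R M w) := by
  obtain ⟨φ, h⟩ := hR
  refine ⟨Formula.iAlls β (φ.relabel Sum.inr : (Lval[[K]]).Formula (Empty ⊕ β)), fun M => ?_⟩
  rw [Sat, Sentence.Realize, Formula.realize_iAlls]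
  simp only [Formula.realize_relabel, ← h]
  rfl

end PreVF

namespace PreVF

variable {K : Type} {α β : Type}

theorem IsTerm.comp {f : ∀ M : PreVF K, (α → M.F) → M.F} (hf : IsTerm f) (g : α → β) :
    IsTerm (fun M (v : β → M.F) => f M (fun i => v (g i))) := by
  obtain ⟨t, ht⟩ := hf
  exact ⟨t.relabel g, fun M v => by rw [Term.realize_relabel, ht]; rfl⟩

theorem IsDef.all₁ {R : ∀ M : PreVF K, (Option α → M.F) → Prop} (hR : IsDef R) :
    IsDef (fun M v => ∀ y : M.F, R M (fun o => o.elim y v)) := by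
  obtain ⟨φ, h⟩ := hR
  have : IsDef (fun M (v : α ⊕ Unit → M.F) => R M (fun o => o.elim (v (.inr ())) (v ∘ .inl))) :=
    ⟨φ.relabel (fun o => o.elim (.inr ()) .inl), fun M v => by
      rw [Formula.realize_relabel, h]
      refine iff_of_eq (congrArg _ (funext fun o => ?_))
      cases o <;> rfl⟩
  obtain ⟨ψ, hψ⟩ := this.all
  refine ⟨ψ, fun M v => (hψ M v).trans ⟨fun H y => H fun _ => y, fun H w => H (w ())⟩⟩

theorem IsDef.ex₁ {R : ∀ M : PreVF K, (Option α → M.F) → Prop} (hR : IsDef R) :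
    IsDef (fun M v => ∃ y : M.F, R M (fun o => o.elim y v)) := by
  obtain ⟨ψ, h⟩ := hR.not.all₁.not
  exact ⟨ψ, fun M v => (h M v).trans (by push Not; rfl)⟩

/-- `x` is not the inverse of an element of `𝒪`. -/
def NonUnit (M : PreVF K) (x : M.F) : Prop := ∀ y : M.F, y ∈ M.O → x * y ≠ 1

theorem IsDef.nonUnit {f : ∀ M : PreVF K, (α → M.F) → M.F} (hf : IsTerm f) :
    IsDef (fun M v => M.NonUnit (f M v)) :=
  IsDef.all₁ (R := fun M v => v none ∈ M.O → ¬ (f M (fun i => v (some i)) * v none = 1))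
    (.imp (.mem (.var _)) (.not (.eq (.mul (hf.comp _) (.var _)) .one)))

theorem isSen_ι_add [Add K] (a b : K) : IsSen (fun M : PreVF K => M.ι (a + b) = M.ι a + M.ι b) :=
  (IsDef.eq (.const _) (.add (.const _) (.const _))).isSen

theorem isSen_ι_mul [Mul K] (a b : K) : IsSen (fun M : PreVF K => M.ι (a * b) = M.ι a * M.ι b) :=
  (IsDef.eq (.const _) (.mul (.const _) (.const _))).isSen

theorem isSen_ι_one [One K] : IsSen (fun M : PreVF K => M.ι 1 = 1) :=
  (IsDef.eq (.const _) .one).isSen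

theorem isSen_ι_mem (a : K) : IsSen (fun M : PreVF K => M.ι a ∈ M.O) :=
  (IsDef.mem (.const _)).isSen

theorem isSen_exists_notMem : IsSen (fun M : PreVF K => ∃ x, x ∉ M.O) :=
  (IsDef.ex₁ (R := fun M (v : Option Empty → M.F) => ¬ v none ∈ M.O) (.not (.mem (.var _)))).isSen

theorem isSen_forall_pow_ne (t : K) (p : ℕ) :
    IsSen (fun M : PreVF K => ∀ x, x ^ p ≠ M.ι t) :=
  (IsDef.all₁ (R := fun M (v : Option Empty → M.F) => ¬ v none ^ p = M.ι t)
    (.not (.eq (.pow (.var _) _) (.const _)))).isSen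

/-- The value of the monic polynomial with the given lower coefficients. -/
def monicEval {R : Type} [CommRing R] {n : ℕ} (c : Fin n → R) (x : R) : R :=
  x ^ n + ∑ i, c i * x ^ (i : ℕ)

/-- The value of the derivative of the monic polynomial with the given lower coefficients. -/
def monicDerivEval {R : Type} [CommRing R] {n : ℕ} (c : Fin n → R) (x : R) : R :=
  n * x ^ (n - 1) + ∑ i, c i * ((i : ℕ) * x ^ ((i : ℕ) - 1))

theorem IsTerm.monicEval {n : ℕ} {c : Fin n → ∀ M : PreVF K, (α → M.F) → M.F}
    {x : ∀ M : PreVF K, (α → M.F) → M.F} (hc : ∀ i, IsTerm (c i)) (hx : IsTerm x) :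
    IsTerm (fun M v => PreVF.monicEval (fun i => c i M v) (x M v)) :=
  .add (hx.pow _) (.sum _ fun i _ => .mul (hc i) (hx.pow _))

theorem IsTerm.monicDerivEval {n : ℕ} {c : Fin n → ∀ M : PreVF K, (α → M.F) → M.F}
    {x : ∀ M : PreVF K, (α → M.F) → M.F} (hc : ∀ i, IsTerm (c i)) (hx : IsTerm x) :
    IsTerm (fun M v => PreVF.monicDerivEval (fun i => c i M v) (x M v)) :=
  .add (.mul (.natCast _) (hx.pow _)) (.sum _ fun i _ => .mul (hc i) (.mul (.natCast _) (hx.pow _)))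

/-- Hensel's lemma for monic polynomials of degree `n`. The variables `some i` stand for the
coefficients, and `none` for the approximate root. -/
def Hensel (n : ℕ) (M : PreVF K) : Prop :=
  ∀ w : Option (Fin n) → M.F, (∀ o, w o ∈ M.O) →
    M.NonUnit (monicEval (fun i => w (some i)) (w none)) →
    ¬ M.NonUnit (monicDerivEval (fun i => w (some i)) (w none)) →
    ∃ b, b ∈ M.O ∧ monicEval (fun i => w (some i)) b = 0 ∧ M.NonUnit (b - w none)

theorem isSen_hensel (n : ℕ) : IsSen (Hensel (K := K) n) :=
  (IsDef.imp (.forall_mem fun o => .mem (.var o))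
    (.imp (.nonUnit (.monicEval (fun _ => .var _) (.var _)))
      (.imp (.not (.nonUnit (.monicDerivEval (fun _ => .var _) (.var _))))
        (IsDef.ex₁ (R := fun M v => v none ∈ M.O ∧
            PreVF.monicEval (fun i => v (some (some i))) (v none) = 0 ∧
            M.NonUnit (v none - v (some none)))
          (.and (.mem (.var _)) (.and (.eq (.monicEval (fun _ => .var _) (.var _)) .zero)
            (.nonUnit (.sub (.var _) (.var _))))))))).isSen_forall

/-- The distinguished subset is a valuation ring. -/
def IsValRing (M : PreVF K) : Prop :=
  ∀ w : Bool → M.F, ((0 : M.F) ∈ M.O ∧ (1 : M.F) ∈ M.O) ∧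
    (w true ∈ M.O → -w true ∈ M.O) ∧
    (w true ∈ M.O → w false ∈ M.O → w true + w false ∈ M.O ∧ w true * w false ∈ M.O) ∧
    (w true * w false = 1 → w true ∈ M.O ∨ w false ∈ M.O)

theorem isSen_isValRing : IsSen (IsValRing (K := K)) :=
  (IsDef.and (.and (.mem .zero) (.mem .one)) (.and (.imp (.mem (.var _)) (.mem (.neg (.var _))))
    (.and (.imp (.mem (.var _)) (.imp (.mem (.var _)) (.and (.mem (.add (.var _) (.var _)))
      (.mem (.mul (.var _) (.var _))))))
      (.imp (.eq (.mul (.var _) (.var _)) .one)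
        (.or (.mem (.var _)) (.mem (.var _))))))).isSen_forall

theorem isValRing_ofVal {F : Type} [Field F] (O : ValuationSubring F) (ι : K → F) :
    (ofVal O ι).IsValRing := fun w => by
  refine ⟨⟨O.zero_mem, O.one_mem⟩, fun h => O.neg_mem _ h,
    fun h h' => ⟨O.add_mem _ _ h h', O.mul_mem _ _ h h'⟩, fun h => ?_⟩
  have h' : w false = (w true)⁻¹ := (inv_eq_of_mul_eq_one_right h).symm
  rw [h']
  exact O.mem_or_inv_mem _

/-- The valuation ring distinguished by `M`. -/
def IsValRing.valuationSubring {M : PreVF K} (h : M.IsValRing) : ValuationSubring M.F where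
  carrier := M.O
  mul_mem' {a b} ha hb := ((h (fun i => bif i then a else b)).2.2.1 ha hb).2
  add_mem' {a b} ha hb := ((h (fun i => bif i then a else b)).2.2.1 ha hb).1
  one_mem' := (h 0).1.2
  zero_mem' := (h 0).1.1
  neg_mem' {a} ha := (h (fun _ => a)).2.1 ha
  mem_or_inv_mem' a := by
    by_cases ha : a = 0
    · exact .inl (ha ▸ (h 0).1.1)
    · exact (h (fun i => bif i then a else a⁻¹)).2.2.2 (mul_inv_cancel₀ ha)

/-- The inclusion of the valuation ring. -/
def inc {F : Type} [Field F] (O : ValuationSubring F) (ι : K → F) : O →+* (ofVal O ι).F :=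
  O.subtype

theorem nonUnit_iff {F : Type} [Field F] {O : ValuationSubring F} {ι : K → F} (x : O) :
    (ofVal O ι).NonUnit (inc O ι x) ↔ x ∈ IsLocalRing.maximalIdeal O := by
  rw [IsLocalRing.mem_maximalIdeal, mem_nonunits_iff, isUnit_iff_exists_inv]
  push Not
  exact ⟨fun h y e => h (inc O ι y) y.2 (by rw [← map_mul, e, map_one]),
    fun h y hy e => h ⟨y, hy⟩ (Subtype.ext e)⟩

open Polynomial in
theorem hensel_iff {F : Type} [Field F] (O : ValuationSubring F) (ι : K → F) :
    (∀ n, (ofVal O ι).Hensel n) ↔ HenselianLocalRing O := by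
  have e₁ {n : ℕ} (c : Fin n → O) (x : O) :
      monicEval (fun i => inc O ι (c i)) (inc O ι x) = inc O ι (monicEval c x) := by
    simp [monicEval]
  have e₂ {n : ℕ} (c : Fin n → O) (x : O) :
      monicDerivEval (fun i => inc O ι (c i)) (inc O ι x) = inc O ι (monicDerivEval c x) := by
    simp [monicDerivEval]
  have e₃ {n : ℕ} (c : Fin n → O) (x : O) :
      (X ^ n + ∑ i, C (c i) * X ^ (i : ℕ) : O[X]).eval x = monicEval c x := by
    simp [monicEval, eval_finsetSum]
  have e₄ {n : ℕ} (c : Fin n → O) (x : O) :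
      (X ^ n + ∑ i, C (c i) * X ^ (i : ℕ) : O[X]).derivative.eval x = monicDerivEval c x := by
    simp [monicDerivEval, eval_finsetSum, derivative_X_pow]
  constructor
  · intro H
    refine { is_henselian := fun f hf a₀ h₁ h₂ => ?_ }
    obtain ⟨n, hn⟩ : ∃ n, n = f.natDegree := ⟨_, rfl⟩
    obtain ⟨c, rfl⟩ : ∃ c : Fin n → O, f = X ^ n + ∑ i, C (c i) * X ^ (i : ℕ) := by
      refine ⟨fun i => f.coeff i, ?_⟩
      rw [Fin.sum_univ_eq_sum_range (fun i => C (f.coeff i) * X ^ i) n, hn]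
      exact hf.as_sum
    rw [e₃] at h₁
    rw [e₄] at h₂
    obtain ⟨b, hb, h₃, h₄⟩ := H n (fun o => o.elim (inc O ι a₀) fun i => inc O ι (c i))
      (by rintro (_ | i); exacts [a₀.2, (c i).2])
      (by
        change (ofVal O ι).NonUnit (monicEval (fun i => inc O ι (c i)) (inc O ι a₀))
        rw [e₁]; exact (nonUnit_iff _).2 h₁)
      (by
        change ¬ (ofVal O ι).NonUnit (monicDerivEval (fun i => inc O ι (c i)) (inc O ι a₀))
        rw [e₂]
        exact fun h => (nonUnit_iff _).1 h h₂)
    refine ⟨⟨b, hb⟩, ?_, (nonUnit_iff (ι := ι) _).1 h₄⟩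
    rw [IsRoot, e₃]
    exact Subtype.ext ((e₁ c ⟨b, hb⟩).symm.trans h₃)
  · intro H n w hw h₁ h₂
    let c : Fin n → O := fun i => ⟨w (some i), hw _⟩
    let a₀ : O := ⟨w none, hw _⟩
    have h₁' := (nonUnit_iff (ι := ι) (monicEval c a₀)).1 (by rw [← e₁]; exact h₁)
    have h₂' : IsUnit (monicDerivEval c a₀) := by
      by_contra h
      exact h₂ ((congrArg (ofVal O ι).NonUnit (e₂ c a₀)).mpr
        ((nonUnit_iff (ι := ι) (monicDerivEval c a₀)).2 h))
    rw [← e₃] at h₁'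
    rw [← e₄] at h₂'
    obtain ⟨b, hb, hb'⟩ := HenselianLocalRing.is_henselian _ (by
      rcases n with _ | n
      · simp
      · refine monic_X_pow_add ?_
        refine (degree_sum_le _ _).trans_lt ?_
        rw [Finset.sup_lt_iff (by exact_mod_cast WithBot.bot_lt_coe _)]
        intro i _
        exact (degree_C_mul_X_pow_le _ _).trans_lt (by exact_mod_cast i.2)) a₀ h₁' h₂'
    rw [IsRoot, e₃] at hb
    refine ⟨inc O ι b, b.2, ?_, (nonUnit_iff (ι := ι) _).2 hb'⟩
    have := e₁ c b
    rw [hb] at this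
    exact this

end PreVF

namespace PreVF

variable {K : Type} {α β : Type}

theorem map_realize_ring {R S : Type} [CommRing R] [CommRing S] (f : R →+* S)
    (t : Language.ring.Term α) (v : α → R) :
    f (@Term.realize _ R (Ring.compatibleRingOfRing R).toStructure _ v t) =
      @Term.realize _ S (Ring.compatibleRingOfRing S).toStructure _ (fun i => f (v i)) t := by
  let := Ring.compatibleRingOfRing R
  let := Ring.compatibleRingOfRing S
  induction t with
  | var => rfl
  | func g ts ih =>
    simp only [Term.realize_func, ← ih]
    cases g <;> simp

theorem exists_residue_boundedFormula {n : ℕ} (φ : Language.ring.BoundedFormula α n) :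
    ∃ ψ : (Lval[[K]]).BoundedFormula α n, ∀ {F : Type} [Field F] (O : ValuationSubring F)
      (ι : K → F) (v : α → O) (xs : Fin n → O),
      ψ.Realize (fun i => inc O ι (v i)) (fun i => inc O ι (xs i)) ↔
      @BoundedFormula.Realize _ (ResF O) (ringStructure _) _ _ φ
        (fun i => IsLocalRing.residue O (v i)) (fun i => IsLocalRing.residue O (xs i)) := by
  induction φ with
  | falsum => exact ⟨⊥, fun _ _ _ _ => Iff.rfl⟩
  | @equal n t₁ t₂ =>
    obtain ⟨ψ, hψ⟩ := IsDef.nonUnit (K := K)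
      (.sub ⟨(ringHom K).onTerm t₁, fun _ _ => rfl⟩ ⟨(ringHom K).onTerm t₂, fun _ _ => rfl⟩)
    refine ⟨BoundedFormula.relabel (n := n) (k := 0) id ψ, fun {F} _ O ι v xs => ?_⟩
    rw [BoundedFormula.realize_relabel]
    simp only [Function.comp_id]
    have hs : (Sum.elim (fun i => inc O ι (v i)) fun i => inc O ι (xs i)) =
        fun i => inc O ι (Sum.elim v xs i) := by ext (_ | _) <;> rfl
    have hr : (Sum.elim (fun i => IsLocalRing.residue O (v i))
        fun i => IsLocalRing.residue O (xs i)) =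
        fun i => IsLocalRing.residue O (Sum.elim v xs i) := by ext (_ | _) <;> rfl
    refine Iff.trans ?_ (Iff.trans (nonUnit_iff (ι := ι)
      (@Term.realize _ O (Ring.compatibleRingOfRing O).toStructure _ (Sum.elim v xs) t₁ -
        @Term.realize _ O (Ring.compatibleRingOfRing O).toStructure _ (Sum.elim v xs) t₂)) ?_)
    · have := hψ (ofVal O ι) (fun i => inc O ι (Sum.elim v xs i))
      beta_reduce at this
      rw [realize_ringHom_onTerm, realize_ringHom_onTerm] at this
      have e (t) := map_realize_ring (inc O ι) t (Sum.elim v xs)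
      rw [map_sub]
      refine Iff.trans ?_
        (this.trans (iff_of_eq (congrArg _ (congrArg₂ _ (e t₁).symm (e t₂).symm))))
      rw [← hs, Formula.Realize]
      refine iff_of_eq (congrArg _ (Subsingleton.elim _ _))
    · rw [← IsLocalRing.residue_eq_zero_iff, map_sub, sub_eq_zero, map_realize_ring,
        map_realize_ring, ← hr]
      exact Iff.rfl
  | rel R => exact R.elim
  | imp _ _ ih₁ ih₂ =>
    obtain ⟨ψ₁, h₁⟩ := ih₁
    obtain ⟨ψ₂, h₂⟩ := ih₂
    refine ⟨ψ₁.imp ψ₂, fun {F} _ O ι v xs => ?_⟩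
    let := ringStructure (ResF O)
    rw [BoundedFormula.realize_imp, h₁, h₂]
    exact Iff.rfl
  | @all n _ ih =>
    obtain ⟨ψ, h⟩ := ih
    refine ⟨(((symO K).boundedFormula₁ (Term.var (Sum.inr (Fin.last n)))).imp ψ).all,
      fun {F} _ O ι v xs => ?_⟩
    let := ringStructure (ResF O)
    rw [BoundedFormula.realize_all, BoundedFormula.realize_all]
    have hs (x : O) : (Fin.snoc (fun i => inc O ι (xs i)) (inc O ι x) :
        Fin (n + 1) → (ofVal O ι).F) =
        fun i => inc O ι ((Fin.snoc xs x : Fin (n + 1) → O) i) :=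
      (Fin.comp_snoc (inc O ι) xs x).symm
    have hr (x : O) : (Fin.snoc (fun i => IsLocalRing.residue O (xs i)) (IsLocalRing.residue O x) :
        Fin (n + 1) → ResF O) =
        fun i => IsLocalRing.residue O ((Fin.snoc xs x : Fin (n + 1) → O) i) :=
      (Fin.comp_snoc (IsLocalRing.residue O) xs x).symm
    constructor
    · intro H x
      obtain ⟨x, rfl⟩ := IsLocalRing.residue_surjective x
      rw [hr, ← h O ι]
      have := H (inc O ι x)
      rw [BoundedFormula.realize_imp, hs x] at this
      refine this ?_
      rw [BoundedFormula.realize_rel₁, Term.realize_var]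
      simp only [Sum.elim_inr, Fin.snoc_last]
      exact x.2
    · intro H x
      rw [BoundedFormula.realize_imp, BoundedFormula.realize_rel₁, Term.realize_var]
      simp only [Sum.elim_inr, Fin.snoc_last]
      intro hx
      have hx : x ∈ O := hx
      have := H (IsLocalRing.residue O ⟨x, hx⟩)
      rw [hr, ← h O ι] at this
      rw [← hs] at this
      exact this

theorem exists_residue_sentence (K : Type) (φ : Language.ring.Sentence) :
    ∃ ψ : (Lval[[K]]).Sentence, ∀ {F : Type} [Field F] (O : ValuationSubring F) (ι : K → F),
      (ofVal O ι).Sat ψ ↔ SatR (ResF O) φ := by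
  obtain ⟨ψ, h⟩ := exists_residue_boundedFormula (K := K) φ
  refine ⟨ψ, fun O ι => ?_⟩
  let := ringStructure (ResF O)
  refine Iff.trans ?_ ((h O ι default default).trans ?_)
  · exact iff_of_eq (congrArg₂ (BoundedFormula.Realize (M := (ofVal O ι).F) ψ)
      (Subsingleton.elim _ _) (Subsingleton.elim _ _))
  · exact iff_of_eq (congrArg₂ (BoundedFormula.Realize φ)
      (Subsingleton.elim _ _) (Subsingleton.elim _ _))

theorem funMap_compatibleRing {F : Type} [Field F] (c : Ring.CompatibleRing F) {n : ℕ}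
    (f : Language.ring.Functions n) (x : Fin n → F) :
    c.toStructure.funMap f x = (ringStructure F).funMap f x := by
  let c' := Ring.compatibleRingOfRing F
  cases f
  · exact (c.funMap_add x).trans (c'.funMap_add x).symm
  · exact (c.funMap_mul x).trans (c'.funMap_mul x).symm
  · exact (c.funMap_neg x).trans (c'.funMap_neg x).symm
  · exact (c.funMap_zero x).trans (c'.funMap_zero x).symm
  · exact (c.funMap_one x).trans (c'.funMap_one x).symm

/-- Łoś's theorem for valued fields with constants. -/
theorem exists_ultraproduct {σ : Type} (u : Ultrafilter σ) {F : σ → Type} [∀ i, Field (F i)]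
    (O : ∀ i, ValuationSubring (F i)) (ι : ∀ i, K → F i) :
    ∃ (L : Type) (_ : Field L) (OL : ValuationSubring L) (j : K → L),
      ∀ φ : (Lval[[K]]).Sentence,
        SatVC K j OL φ ↔ ∀ᶠ i in (u : Filter σ), SatVC K (ι i) (O i) φ := by
  let (i : σ) : (Lval[[K]]).Structure (F i) := valCStructure K (F i) (ι i) (O i)
  let N := (u : Filter σ).Product F
  have los (φ : (Lval[[K]]).Sentence) : N ⊨ φ ↔ ∀ᶠ i in (u : Filter σ), F i ⊨ φ :=
    Ultraproduct.sentence_realize φ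
  let S : (Lval[[K]]).Structure N := inferInstance
  let : Language.ring.Structure N := (ringHom K).reduct N
  have : (ringHom K).IsExpansionOn N := LHom.isExpansionOn_reduct _ _
  have : Theory.field.Model N := by
    rw [Theory.model_iff]
    intro φ hφ
    rw [← LHom.realize_onSentence N (ringHom K), los]
    refine .of_forall fun i => ?_
    have hmodel : @Theory.Model _ (F i) (ringStructure (F i)) Theory.field := by
      let := Ring.compatibleRingOfRing (F i)
      exact (inferInstance : Theory.field.Model (F i))
    let : Language.ring.Structure (F i) := ringStructure (F i)
    have : (ringHom K).IsExpansionOn (F i) := ⟨fun _ _ => rfl, fun _ _ => rfl⟩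
    rw [LHom.realize_onSentence]
    exact Theory.realize_sentence_of_mem Theory.field hφ
  let : Field N := FirstOrder.Field.fieldOfModelField N
  let M : PreVF K := ⟨N, {x | S.RelMap (symO K) ![x]},
    fun c => S.funMap (Sum.inr c : (Lval[[K]]).Functions 0) default⟩
  have hS : M.toStructure = S := by
    refine Structure.ext ?_ ?_
    · funext n f x
      match n, f with
      | n, Sum.inl (Sum.inl f) =>
        exact (funMap_compatibleRing (Field.compatibleRingOfModelField N) f x).symm
      | 0, Sum.inr c =>
        exact congrArg (S.funMap (Sum.inr c : (Lval[[K]]).Functions 0))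
          (Subsingleton.elim (default : Fin 0 → N) x)
    · funext n r x
      match n, r with
      | 1, Sum.inl (Sum.inr r) =>
        exact congrArg (S.RelMap (symO K)) (funext fun i =>
          (Matrix.cons_val_fin_one (x 0) ![] i).trans (congrArg x (Subsingleton.elim 0 i)))
  have hsat (φ : (Lval[[K]]).Sentence) : M.Sat φ ↔ N ⊨ φ := by
    change @Sentence.Realize _ M.F M.toStructure φ ↔ @Sentence.Realize _ N S φ
    rw [← hS]
  obtain ⟨θ, hθ⟩ := isSen_isValRing (K := K)
  have hM : M.IsValRing := by
    rw [← hθ, hsat, los]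
    exact .of_forall fun i => (hθ (ofVal (O i) (ι i))).2 (isValRing_ofVal _ _)
  refine ⟨N, inferInstance, hM.valuationSubring, M.ι, fun φ => ?_⟩
  exact (hsat φ).trans (los φ)

end PreVF

section FunctionField

open Polynomial IntermediateField
open scoped IntermediateField.algebraAdjoinAdjoin

instance Polynomial.hasFiniteQuotients (k : Type*) [Field k] [Finite k] :
    Ring.HasFiniteQuotients k[X] where
  finiteQuotient {I} hI := by
    obtain ⟨f, hf, hf0⟩ := Submodule.exists_mem_ne_zero_of_ne_bot hI
    have : Module.Finite k (AdjoinRoot f) := (AdjoinRoot.powerBasis hf0).finite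
    have : Finite (k[X] ⧸ Ideal.span {f}) := Module.finite_of_finite (M := AdjoinRoot f) k
    exact Finite.of_surjective _ (Ideal.Quotient.factor_surjective
      ((Ideal.span_singleton_le_iff_mem I).2 hf))

variable {k K : Type} [Field k] [Field K] [Algebra k K]

/-- `t` is a separating element of the function field `K/k`. -/
structure IsSeparating (k : Type) {K : Type} [Field k] [Field K] [Algebra k K] (t : K) :
    Prop where
  transcendental : Transcendental k t
  finite : FiniteDimensional k⟮t⟯ K
  separable : Algebra.IsSeparable k⟮t⟯ K

theorem IsSeparating.inv {t : K} (h : IsSeparating k t) : IsSeparating k t⁻¹ := by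
  have e : k⟮t⁻¹⟯ = k⟮t⟯ := by
    apply le_antisymm
    · exact adjoin_simple_le_iff.2 (inv_mem (mem_adjoin_simple_self k t))
    · exact adjoin_simple_le_iff.2 (by simpa using inv_mem (mem_adjoin_simple_self k t⁻¹))
  refine ⟨fun H => h.transcendental (by simpa using H.inv), ?_, ?_⟩
  · rw [e]; exact h.finite
  · rw [e]; exact h.separable

theorem IsFunctionField.exists_isSeparating [Finite k] (hK : IsFunctionField k K) :
    ∃ t : K, IsSeparating k t := by
  obtain ⟨t, ht, hfin⟩ := hK.exists_primitive
  have htb : IsTranscendenceBasis k (fun _ : Unit => t) := by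
    have := Algebra.IsAlgebraic.of_finite k⟮t⟯ K
    rw [isTranscendenceBasis_iff_algebraicIndependent_isAlgebraic,
      algebraicIndependent_unique_type_iff, Set.range_const]
    exact ⟨ht, .trans _ k⟮t⟯ _⟩
  have : Algebra.EssFiniteType k k⟮t⟯ := essFiniteType_iff.2 ⟨{t}, by simp⟩
  have : Algebra.EssFiniteType k K := .comp k k⟮t⟯ K
  obtain ⟨s, hs, hsep⟩ := exists_isTranscendenceBasis_and_isSeparable_of_perfectField k K
  obtain ⟨u, rfl⟩ : ∃ u, s = {u} := by
    rw [← Finset.card_eq_one, ← Fintype.card_coe, ← Fintype.card_unit,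
      ← Nat.cast_inj (R := Cardinal.{0}), ← Cardinal.mk_fintype, ← Cardinal.mk_fintype]
    exact hs.cardinalMk_eq htb
  rw [Finset.coe_singleton] at hsep
  have : Algebra.EssFiniteType k⟮u⟯ K := .of_comp k _ _
  exact ⟨u, hs.1.transcendental ⟨u, by simp⟩, Algebra.finite_of_essFiniteType_of_isAlgebraic, hsep⟩

theorem IsSeparating.exists_dedekind [Finite k] {t : K} (h : IsSeparating k t) :
    ∃ B : Subring K, IsDedekindDomain B ∧ Ring.HasFiniteQuotients B ∧ IsFractionRing B K ∧
      ∀ v : ValuationSubring K, IsPlace (algebraMap k K) v → t ∈ v → B ≤ v.toSubring := by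
  let A := Algebra.adjoin k {t}
  have := h.finite
  have := h.separable
  let φ : k[X] →ₐ[k] A := aeval ⟨t, Algebra.self_mem_adjoin_singleton k t⟩
  have hφ : Function.Surjective φ := by
    intro x
    obtain ⟨f, hf⟩ := (Algebra.adjoin_singleton_eq_range_aeval k t).le x.2
    refine ⟨f, Subtype.ext ?_⟩
    rw [← hf]
    exact (aeval_algHom_apply A.val _ f).symm
  have : IsPrincipalIdealRing A := .of_surjective φ.toRingHom hφ
  have : Ring.HasFiniteQuotients A := by
    let := φ.toRingHom.toAlgebra
    have : Module.Finite k[X] A := .of_surjective (Algebra.linearMap k[X] A) hφ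
    exact .of_module_finite k[X] A
  have : Module.Finite A (integralClosure A K) := IsIntegralClosure.finite A k⟮t⟯ K _
  refine ⟨(integralClosure A K).toSubring, integralClosure.isDedekindDomain A k⟮t⟯ K,
    .of_module_finite A (integralClosure A K),
    integralClosure.isFractionRing_of_finite_extension k⟮t⟯ K, fun v hv ht x hx => ?_⟩
  have hA (a : A) : (a : K) ∈ v := by
    refine Algebra.adjoin_induction (p := fun x _ => x ∈ v) ?_ hv.2
      (fun _ _ _ _ => v.add_mem _ _) (fun _ _ _ _ => v.mul_mem _ _) a.2
    rintro _ rfl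
    exact ht
  obtain ⟨f, hf, hfx⟩ := hx
  let i : A →+* v := A.subtype.codRestrict v hA
  obtain ⟨y, rfl⟩ := IsIntegrallyClosed.isIntegral_iff.1
    (⟨f.map i, hf.map i, by rwa [eval₂_map]⟩ : IsIntegral v x)
  exact y.2

end FunctionField

section FunctionField

open Polynomial IntermediateField

variable {k K : Type} [Field k] [Field K] [Algebra k K]

/-- The contraction of the maximal ideal of a valuation ring to a subring. -/
def ValuationSubring.center (v : ValuationSubring K) {B : Subring K} (h : B ≤ v.toSubring) :
    Ideal B :=
  (IsLocalRing.maximalIdeal v).comap (Subring.inclusion h)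

theorem ValuationSubring.inv_mem_of_notMem_center {v : ValuationSubring K} {B : Subring K}
    (h : B ≤ v.toSubring) {b : B} (hb : b ∉ v.center h) : (b : K)⁻¹ ∈ v := by
  obtain ⟨u, hu⟩ : IsUnit (Subring.inclusion h b) := by
    by_contra H
    exact hb ((IsLocalRing.mem_maximalIdeal _).2 H)
  have : ((u⁻¹ : (v)ˣ) : v).1 = (b : K)⁻¹ := by
    refine eq_inv_of_mul_eq_one_left ?_
    have := congrArg Subtype.val u.inv_mul
    rw [hu] at this
    exact this
  exact this ▸ (u⁻¹ : (v)ˣ).val.2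

theorem ValuationSubring.center_ne_bot {v : ValuationSubring K} {B : Subring K}
    [IsFractionRing B K] (h : B ≤ v.toSubring) (hv : v ≠ ⊤) : v.center h ≠ ⊥ := by
  intro H
  refine hv (top_unique fun x _ => ?_)
  obtain ⟨a, b, hb, rfl⟩ := IsFractionRing.div_surjective (A := B) x
  rw [div_eq_mul_inv]
  refine v.mul_mem _ _ (h a.2) (inv_mem_of_notMem_center h ?_)
  rw [H]
  exact fun h => nonZeroDivisors.ne_zero hb h

instance ValuationSubring.center_isPrime {v : ValuationSubring K} {B : Subring K}
    (h : B ≤ v.toSubring) : (v.center h).IsPrime :=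
  Ideal.IsPrime.comap _

/-- The center of a nontrivial valuation ring as a nonzero prime. -/
def ValuationSubring.centerPrime {v : ValuationSubring K} {B : Subring K}
    [IsFractionRing B K] (h : B ≤ v.toSubring) (hv : v ≠ ⊤) :
    IsDedekindDomain.HeightOneSpectrum B :=
  ⟨v.center h, inferInstance, center_ne_bot h hv⟩

theorem ValuationSubring.eq_atPrime {v : ValuationSubring K} {B : Subring K}
    [IsDedekindDomain B] [IsFractionRing B K] (h : B ≤ v.toSubring) (hv : v ≠ ⊤) :
    (centerPrime h hv).valuationSubringAtPrime K = v := by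
  refine eq_of_le_of_ne_top _ ?_ hv
  rintro x ⟨a, s, hs, rfl⟩
  exact v.mul_mem _ _ (h a.2) (inv_mem_of_notMem_center h hs)

theorem ValuationSubring.isDiscreteValuationRing_of_le {v : ValuationSubring K} {B : Subring K}
    [IsDedekindDomain B] [IsFractionRing B K] (h : B ≤ v.toSubring) (hv : v ≠ ⊤) :
    IsDiscreteValuationRing v := by
  have : IsDiscreteValuationRing ((centerPrime h hv).valuationSubringAtPrime K) :=
    IsLocalization.AtPrime.isDiscreteValuationRing_of_dedekind_domain B
      (centerPrime h hv).ne_bot _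
  rwa [eq_atPrime h hv] at this

theorem ValuationSubring.finite_residueField_of_le {v : ValuationSubring K} {B : Subring K}
    [IsDedekindDomain B] [Ring.HasFiniteQuotients B] [IsFractionRing B K]
    (h : B ≤ v.toSubring) (hv : v ≠ ⊤) : Finite (ResF v) := by
  have : Finite (B ⧸ v.center h) := Ring.HasFiniteQuotients.finiteQuotient (center_ne_bot h hv)
  let f : B ⧸ v.center h →+* ResF v := Ideal.quotientMap _ (Subring.inclusion h) le_rfl
  have hf : (v.center h).IsMaximal :=
    Ring.HasFiniteQuotients.maximalOfPrime (center_ne_bot h hv)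
  refine Finite.of_surjective f fun y => ?_
  obtain ⟨⟨x, hx⟩, rfl⟩ := IsLocalRing.residue_surjective y
  obtain ⟨a, s, hs, rfl⟩ := (eq_atPrime h hv).ge hx
  obtain ⟨c, i, hi, hc⟩ := hf.exists_inv (x := s) hs
  have hs0 : (s : K) ≠ 0 := fun e => hs (by
    rw [show s = 0 from Subtype.ext e]; exact Ideal.zero_mem _)
  refine ⟨Ideal.Quotient.mk _ (a * c), ?_⟩
  have e : Subring.inclusion h (a * c) =
      ⟨algebraMap B K a * (algebraMap B K s)⁻¹, hx⟩ * (1 - Subring.inclusion h i) := by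
    rw [← map_one (Subring.inclusion h), ← map_sub, ← hc, add_sub_cancel_right]
    refine Subtype.ext ?_
    change (a : K) * c = a * (s : K)⁻¹ * (c * s)
    field_simp
  have hi : IsLocalRing.residue v (Subring.inclusion h i) = 0 :=
    (IsLocalRing.residue_eq_zero_iff _).2 hi
  change IsLocalRing.residue v (Subring.inclusion h (a * c)) = _
  rw [e, map_mul, map_sub, hi, map_one, sub_zero, mul_one]

theorem IsSeparating.finite_notMem [Finite k] {t : K} (h : IsSeparating k t) (x : K) :
    {v : Places k K | t ∈ v.1 ∧ x ∉ v.1}.Finite := by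
  classical
  obtain ⟨B, _, _, _, hB⟩ := h.exists_dedekind
  obtain ⟨a, b, hb, rfl⟩ := IsFractionRing.div_surjective (A := B) x
  have hB' (v : Places k K) (hv : t ∈ v.1) : B ≤ v.1.toSubring := hB v.1 v.2 hv
  refine Set.Finite.of_injOn
    (f := fun v : Places k K => if h : B ≤ v.1.toSubring then v.1.center h else ⊥) ?_ ?_
    (Ring.HasFiniteQuotients.finite_setOfPred_mem b (nonZeroDivisors.ne_zero hb))
  · rintro v ⟨h₁, h₂⟩
    simp only [dif_pos (hB' v h₁), Set.mem_ofPred_eq]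
    by_contra H
    refine h₂ ?_
    rw [div_eq_mul_inv]
    exact v.1.mul_mem _ _ (hB' v h₁ a.2) (ValuationSubring.inv_mem_of_notMem_center _ H)
  · rintro v ⟨h₁, -⟩ w ⟨h₂, -⟩ e
    simp only [dif_pos (hB' v h₁), dif_pos (hB' w h₂)] at e
    apply Subtype.ext
    rw [← ValuationSubring.eq_atPrime (hB' v h₁) v.2.1,
      ← ValuationSubring.eq_atPrime (hB' w h₂) w.2.1]
    exact congrArg _ (IsDedekindDomain.HeightOneSpectrum.ext e)

theorem IsFunctionField.finite_notMem [Finite k] (hK : IsFunctionField k K) (x : K) :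
    {v : Places k K | x ∉ v.1}.Finite := by
  obtain ⟨t, ht⟩ := hK.exists_isSeparating
  refine ((ht.finite_notMem x).union (ht.inv.finite_notMem x)).subset fun v hv => ?_
  exact (v.1.mem_or_inv_mem t).imp (⟨·, hv⟩) (⟨·, hv⟩)

theorem IsFunctionField.place [Finite k] (hK : IsFunctionField k K) (v : Places k K) :
    IsDiscreteValuationRing v.1 ∧ Finite (ResF v.1) := by
  obtain ⟨t, ht⟩ := hK.exists_isSeparating
  obtain ⟨t, ht, htv⟩ : ∃ t, IsSeparating k t ∧ t ∈ v.1 :=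
    (v.1.mem_or_inv_mem t).elim (⟨t, ht, ·⟩) (⟨t⁻¹, ht.inv, ·⟩)
  obtain ⟨B, _, _, _, hB⟩ := ht.exists_dedekind
  exact ⟨ValuationSubring.isDiscreteValuationRing_of_le (hB v.1 v.2 htv) v.2.1,
    ValuationSubring.finite_residueField_of_le (hB v.1 v.2 htv) v.2.1⟩

end FunctionField

namespace Valued

open UniformSpace Filter

variable {K Γ₀ : Type*} [Field K] [LinearOrderedCommGroupWithZero Γ₀]

theorem exists_setOf_lt_subset [Valued K Γ₀] {s : Set K} (hs : s ∈ nhds (0 : K)) :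
    ∃ c : K, c ≠ 0 ∧ ∀ x, v x < v c → x ∈ s := by
  obtain ⟨γ, hγ⟩ := Valued.mem_nhds_zero.1 hs
  obtain ⟨c, hc⟩ := MonoidWithZeroHom.ValueGroup₀.restrict₀_surjective
    (MonoidWithZeroHom.ofClass (v : Valuation K Γ₀)) γ.1
  replace hc : v.restrict c = γ.1 := hc
  refine ⟨c, ?_, fun x hx => hγ ?_⟩
  · rintro rfl
    simp at hc
    exact γ.ne_zero hc.symm
  · show v.restrict x < _
    rw [← hc]
    exact (Valuation.restrict_lt_iff _).2 hx

theorem isClopen_le [Valued K Γ₀] {c : K} (hc : c ≠ 0) : IsClopen {x : K | v x ≤ v c} := by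
  have h := Valued.isClopen_closedBall (R := K) (r := v.restrict c) (by simpa using hc)
  simpa [Valuation.restrict_le_iff] using h

theorem isClopen_completion_le [hv : Valued K Γ₀] {c : K} (hc : c ≠ 0) :
    IsClopen {x : Completion K | extensionValuation x ≤ hv.v c} := by
  have h := isClopen_le (K := Completion K) (c := (c : Completion K)) (by simpa)
  have h2 : Valued.v (c : Completion K) = hv.v c := by simp
  rw [h2] at h
  exact h

theorem exists_extensionValuation_sub_le [hv : Valued K Γ₀] {c : K} (hc : c ≠ 0)
    (x : Completion K) : ∃ r : K, extensionValuation (x - (r : Completion K)) ≤ hv.v c := by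
  have : IsOpen {y : Completion K | extensionValuation (x - y) ≤ hv.v c} :=
    (isClopen_completion_le hc).2.preimage (f := fun y => x - y) (by fun_prop)
  obtain ⟨r, hr⟩ := Completion.denseRange_coe.exists_mem_open this ⟨x, by simp⟩
  exact ⟨r, hr⟩

theorem exists_limit_completion [hv : Valued K Γ₀] (f : ℕ → Completion K) (c : ℕ → K)
    (hc : ∀ n, c n ≠ 0)
    (hf : ∀ m n, m ≤ n → extensionValuation (f n - f m) ≤ hv.v (c m))
    (hd : ∀ d ≠ 0, ∃ n, hv.v (c n) < hv.v d) :
    ∃ x, ∀ n, extensionValuation (x - f n) ≤ hv.v (c n) := by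
  have hcau : CauchySeq f := by
    rw [cauchySeq_iff]
    intro V hV
    rw [uniformity_eq_comap_nhds_zero] at hV
    obtain ⟨s, hs, hsV⟩ := hV
    obtain ⟨d, hd0, hds⟩ := exists_setOf_lt_subset hs
    obtain ⟨e, he⟩ := exists_coe_eq_v d
    change Valued.v d = _ at he
    have he0 : e ≠ 0 := by
      rintro rfl
      simp at he
      exact hd0 he
    obtain ⟨n, hn⟩ := hd e he0
    refine ⟨n, fun i hi j hj => hsV (hds _ ?_)⟩
    change extensionValuation (f j - f i) < Valued.v d
    rw [he, ← sub_sub_sub_cancel_right _ _ (f n)]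
    exact ((Valuation.map_sub _ _ _).trans (max_le (hf n j hj) (hf n i hi))).trans_lt hn
  obtain ⟨x, hx⟩ := cauchySeq_tendsto_of_complete hcau
  refine ⟨x, fun n => ?_⟩
  have : IsClosed {y : Completion K | extensionValuation (y - f n) ≤ hv.v (c n)} :=
    (isClopen_completion_le (hc n)).1.preimage (f := fun y => y - f n) (by fun_prop)
  exact this.mem_of_tendsto hx (eventually_atTop.2 ⟨n, fun m hm => hf n m hm⟩)

end Valued

/-- The valuation on the completion extends the given one with the same values, every element is
approximated by elements of `K`, and Cauchy sequences converge. -/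
theorem exists_cmpl_valuation (K : Type*) [Field K] (v : ValuationSubring K) :
    ∃ V : Valuation (Cmpl K v) v.ValueGroup, cmplO K v = V.valuationSubring ∧
      (∀ x, V (cmplEmb K v x) = v.valuation x) ∧
      (∀ x, ∃ r, V x = v.valuation r) ∧
      (∀ x, ∀ c ≠ 0, ∃ r, V (x - cmplEmb K v r) ≤ v.valuation c) ∧
      ∀ (f : ℕ → Cmpl K v) (c : ℕ → K), (∀ n, c n ≠ 0) →
        (∀ m n, m ≤ n → V (f n - f m) ≤ v.valuation (c m)) →
        (∀ d ≠ 0, ∃ n, v.valuation (c n) < v.valuation d) →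
        ∃ x, ∀ n, V (x - f n) ≤ v.valuation (c n) := by
  let := Valued.mk' v.valuation
  exact ⟨(Valued.v : Valuation (UniformSpace.Completion K) v.ValueGroup), rfl,
    Valued.valuedCompletion_apply, Valued.exists_coe_eq_v,
    fun x _ hc => Valued.exists_extensionValuation_sub_le hc x, Valued.exists_limit_completion⟩

namespace ValuationSubring

variable {K : Type*} [Field K] (v : ValuationSubring K)

theorem exists_uniformizer [IsDiscreteValuationRing v] : ∃ π : K, π ≠ 0 ∧
    (∀ x, v.valuation x < 1 ↔ v.valuation x ≤ v.valuation π) ∧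
    ∀ d ≠ 0, ∃ n : ℕ, v.valuation (π ^ n) < v.valuation d := by
  obtain ⟨π, hπ⟩ := IsDiscreteValuationRing.exists_irreducible v
  have hπ0 : (π : K) ≠ 0 := by simpa using hπ.ne_zero
  have hπ1 : v.valuation (π : K) < 1 :=
    (v.valuation_lt_one_iff π).1 (hπ.maximalIdeal_eq ▸ Ideal.mem_span_singleton_self π)
  refine ⟨π, hπ0, fun x => ⟨fun hx => ?_, fun hx => hx.trans_lt hπ1⟩, fun d hd => ?_⟩
  · lift x to v using (v.valuation_le_one_iff x).1 hx.le
    have := (v.valuation_lt_one_iff x).2 hx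
    rw [hπ.maximalIdeal_eq, Ideal.mem_span_singleton] at this
    obtain ⟨y, rfl⟩ := this
    simpa using mul_le_of_le_one_right' (v.valuation_le_one y)
  · rcases v.mem_or_inv_mem d with h | h
    · lift d to v using h
      obtain ⟨n, u, hu⟩ := IsDiscreteValuationRing.associated_pow_irreducible
        (by simpa using hd : d ≠ 0) hπ
      refine ⟨n + 1, ?_⟩
      have h1 := v.valuation_unit u
      have h2 : v.valuation (d : K) = v.valuation ((π : K) ^ n) := by
        have := congrArg (fun x : v => v.valuation (x : K)) hu
        simpa [h1] using this
      rw [h2, pow_succ, map_mul]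
      exact mul_lt_of_lt_one_right (by simp [zero_lt_iff, hπ0]) hπ1
    · refine ⟨1, ?_⟩
      have := (v.valuation_le_one_iff _).2 h
      rw [map_inv₀, inv_le_one₀ (by simp [zero_lt_iff, hd])] at this
      simpa using hπ1.trans_le this

end ValuationSubring

section

variable {K : Type*} [Field K] {v : ValuationSubring K}

theorem cmplEmb_mem {x : K} : cmplEmb K v x ∈ cmplO K v ↔ x ∈ v := by
  obtain ⟨V, hO, hV, -⟩ := exists_cmpl_valuation K v
  rw [hO, Valuation.mem_valuationSubring_iff, hV, v.valuation_le_one_iff]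

theorem cmplO_ne_top (h : v ≠ ⊤) : cmplO K v ≠ ⊤ := fun H =>
  h (top_unique fun _ _ => cmplEmb_mem.1 (H ▸ ValuationSubring.mem_top _))

theorem henselianLocalRing_cmplO [IsDiscreteValuationRing v] :
    HenselianLocalRing (cmplO K v) := by
  obtain ⟨V, hO, hV, hval, -, hlim⟩ := exists_cmpl_valuation K v
  obtain ⟨π, hπ0, hπ, hpow⟩ := v.exists_uniformizer
  rw [hO]
  let I := IsLocalRing.maximalIdeal V.valuationSubring
  have hI (n : ℕ) (x : V.valuationSubring) : x ∈ I ^ n ↔ V x ≤ v.valuation (π ^ n) := by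
    let p : V.valuationSubring := ⟨cmplEmb K v π, by
      rw [Valuation.mem_valuationSubring_iff, hV]
      exact ((hπ π).2 le_rfl).le⟩
    have hdvd (a b : V.valuationSubring) : a ∣ b ↔ V b ≤ V a :=
      Valuation.valuationSubring.integers V |>.le_iff_dvd.symm
    have hIp : I = Ideal.span {p} := by
      ext y
      obtain ⟨r, hr⟩ := hval y
      rw [Ideal.mem_span_singleton, hdvd, Valuation.mem_maximalIdeal_iff, hr, hπ]
      change _ ↔ _ ≤ V (cmplEmb K v π)
      rw [hV]
    rw [hIp, Ideal.span_singleton_pow, Ideal.mem_span_singleton, hdvd]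
    change _ ≤ V (cmplEmb K v π ^ n) ↔ _
    rw [map_pow, hV, map_pow]
  have : IsAdicComplete I V.valuationSubring :=
    { haus' := fun x hx => by
        simp only [SModEq.zero, smul_eq_mul, Ideal.mul_top, hI] at hx
        by_contra hx0
        obtain ⟨r, hr⟩ := hval x
        have hr0 : r ≠ 0 := by
          rintro rfl
          simp at hr
          exact hx0 hr
        obtain ⟨n, hn⟩ := hpow r hr0
        exact (hr ▸ hx n).not_gt hn
      prec' := fun f hf => by
        simp only [SModEq.sub_mem, smul_eq_mul, Ideal.mul_top, hI] at hf ⊢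
        obtain ⟨x, hx⟩ := hlim (fun n => f n) (fun n => π ^ n) (fun n => pow_ne_zero _ hπ0)
          (fun m n h => by simpa [Valuation.map_sub_swap] using hf h) hpow
        have hx1 : V x ≤ 1 := by
          have := V.map_add (x - f 0) (f 0)
          simp only [sub_add_cancel] at this
          refine this.trans (max_le (by simpa using hx 0) (f 0).2)
        exact ⟨⟨x, hx1⟩, fun n => by simpa [Valuation.map_sub_swap] using hx n⟩ }
  have h := IsAdicComplete.henselianRing V.valuationSubring I
  exact ⟨fun f hf a h0 h1 => h.is_henselian f hf a h0 (h1.map _)⟩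

theorem finite_resF_cmplO [IsDiscreteValuationRing v] [Finite (ResF v)] :
    Finite (ResF (cmplO K v)) := by
  obtain ⟨V, hO, hV, -, happ, -⟩ := exists_cmpl_valuation K v
  obtain ⟨π, hπ0, hπ, -⟩ := v.exists_uniformizer
  let f : v →+* ResF (cmplO K v) := (IsLocalRing.residue _).comp
    (((cmplEmb K v).comp v.subtype).codRestrict (cmplO K v) fun x => cmplEmb_mem.2 x.2)
  have hf : Function.Surjective f := by
    intro y
    obtain ⟨⟨x, hx⟩, rfl⟩ := IsLocalRing.residue_surjective y
    obtain ⟨r, hr⟩ := happ x π hπ0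
    have hr1 : V (x - cmplEmb K v r) < 1 := hr.trans_lt ((hπ π).2 le_rfl)
    have hx1 : V x ≤ 1 := by rwa [hO, Valuation.mem_valuationSubring_iff] at hx
    have hrv : r ∈ v := by
      rw [← v.valuation_le_one_iff, ← hV]
      have := V.map_sub x (x - cmplEmb K v r)
      rw [sub_sub_cancel] at this
      exact this.trans (max_le hx1 hr1.le)
    refine ⟨⟨r, hrv⟩, ?_⟩
    refine (Ideal.Quotient.eq).2 ?_
    have hmax (O : ValuationSubring (Cmpl K v)) (h : O = V.valuationSubring) (z : O) :
        z ∈ IsLocalRing.maximalIdeal O ↔ V z < 1 := by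
      subst h
      exact V.mem_maximalIdeal_iff
    refine (hmax _ hO _).2 ?_
    rw [Valuation.map_sub_swap] at hr1
    exact hr1
  have hk := RingHom.ker_isMaximal_of_surjective f hf
  rw [IsLocalRing.isMaximal_iff] at hk
  have : Finite (v ⧸ RingHom.ker f) := by rwa [hk]
  exact Finite.of_equiv _ (RingHom.quotientKerEquivOfSurjective hf).toEquiv

end

section

open Polynomial IntermediateField

/-- Linear independence over the field of `p`-th powers of the powers of a non-`p`-th power. -/
theorem eq_zero_of_sum_pow_mul_pow_eq_zero {L : Type*} [Field L] {p : ℕ} [hp : Fact p.Prime]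
    [CharP L p] {t : L} (ht : ∀ y : L, y ^ p ≠ t) (a : Fin p → L)
    (h : ∑ i, a i ^ p * t ^ (i : ℕ) = 0) (i : Fin p) : a i = 0 := by
  have hirr := X_pow_sub_C_irreducible_of_prime hp.out ht
  set q : L[X] := X ^ p - C t with hq
  let g : L[X] := ∑ i, C (a i) * X ^ (i : ℕ)
  have hg : g.eval₂ (frobenius L p) t = 0 := by
    simpa [g, eval₂_finsetSum, frobenius_def] using h
  have hq0 : q.eval₂ (frobenius L p) t = 0 := by simp [q, frobenius_def]
  have hdeg : g.degree < q.degree := by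
    rw [hq, degree_X_pow_sub_C hp.out.pos]
    exact degree_sum_fin_lt a
  have hg0 : g = 0 := by
    by_contra hg0
    have hco : IsCoprime q g := by
      rw [hirr.coprime_iff_not_dvd]
      exact fun hdvd => (degree_le_of_dvd hdvd hg0).not_gt hdeg
    obtain ⟨u, w, huw⟩ := hco
    simpa [eval₂_mul, hg, hq0] using congrArg (eval₂ (frobenius L p) t) huw
  have := congrArg (fun f => f.coeff i) hg0
  simpa [g, finsetSum_coeff, coeff_X_pow, Fin.val_inj] using this

/-- A field generated over its `p`-th powers by an element that stays a non-`p`-th power in the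
extension is separably extended. -/
theorem isReduced_tensorProduct_of_pow_ne {K L E : Type*} [Field K] [Field L] [Field E]
    [Algebra K L] [Algebra K E] {p : ℕ} [hp : Fact p.Prime] [CharP K p] {t : K}
    (hK : ∀ x : K, ∃ c : Fin p → K, x = ∑ i, c i ^ p * t ^ (i : ℕ))
    (ht : ∀ y : L, y ^ p ≠ algebraMap K L t) : IsReduced (TensorProduct K L E) := by
  have : CharP L p := charP_of_injective_algebraMap (algebraMap K L).injective p
  have : CharP E p := charP_of_injective_algebraMap (algebraMap K E).injective p
  have : CharP (TensorProduct K E L) p :=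
    charP_of_injective_algebraMap (algebraMap K (TensorProduct K E L)).injective p
  let b := Module.Basis.ofVectorSpace K L
  have hb : LinearIndependent K fun i => b i ^ p := by
    rw [linearIndependent_iff']
    intro s x hx i hi
    choose c hc using fun i => hK (x i)
    have h (j : Fin p) : ∑ i ∈ s, c i j • b i = 0 := by
      refine eq_zero_of_sum_pow_mul_pow_eq_zero ht (fun j => ∑ i ∈ s, c i j • b i) ?_ j
      rw [← hx]
      simp_rw [sum_pow_char, Finset.sum_mul]
      rw [Finset.sum_comm]
      refine Finset.sum_congr rfl fun i _ => ?_
      rw [hc i, Finset.sum_smul]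
      refine Finset.sum_congr rfl fun j _ => ?_
      simp only [Algebra.smul_def, map_mul, map_pow]
      ring
    rw [hc i]
    refine Finset.sum_eq_zero fun j _ => ?_
    rw [linearIndependent_iff'.1 b.linearIndependent s _ (h j) i hi, zero_pow hp.out.ne_zero,
      zero_mul]
  have hr : IsReduced (TensorProduct K E L) := by
    rw [isReduced_iff_pow_one_lt p hp.out.one_lt]
    intro z hz
    have hz' := (Algebra.TensorProduct.basis E b).linearCombination_repr z
    set e := (Algebra.TensorProduct.basis E b).repr z
    have h0 := linearIndependent_iff'.1
      (Module.Flat.linearIndependent_one_tmul (S := E) hb) e.support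
      (fun i => e i ^ p) (by
        rw [← hz, ← hz', Finsupp.linearCombination_apply, Finsupp.sum, sum_pow_char]
        refine Finset.sum_congr rfl fun i _ => ?_
        rw [_root_.smul_pow, Algebra.TensorProduct.basis_apply,
          Algebra.TensorProduct.tmul_pow, one_pow])
    have he : e = 0 := by
      ext i
      by_contra hi
      exact hi (pow_eq_zero_iff hp.out.ne_zero |>.1 (h0 i (Finsupp.mem_support_iff.2 hi)))
    rw [← hz', he, map_zero]
  exact isReduced_of_injective (Algebra.TensorProduct.comm K L E)
    (Algebra.TensorProduct.comm K L E).injective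

theorem IsSeparating.exists_eq_sum {k K : Type} [Field k] [Finite k] [Field K] [Algebra k K]
    {p : ℕ} [hp : Fact p.Prime] [CharP k p] {t : K} (ht : IsSeparating k t) (x : K) :
    ∃ c : Fin p → K, x = ∑ i, c i ^ p * t ^ (i : ℕ) := by
  have : CharP K p := charP_of_injective_algebraMap (algebraMap k K).injective p
  have : CharP k⟮t⟯ p := charP_of_injective_algebraMap (algebraMap k k⟮t⟯).injective p
  have := ht.separable
  let F : Subfield K := (frobenius K p).fieldRange
  have hF (y : K) : y ^ p ∈ F := ⟨y, rfl⟩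
  have hx : x ∈ k⟮t⟯⟮x ^ p⟯ := by
    rw [← adjoin_simple_eq_adjoin_pow_expChar_of_isSeparable' k⟮t⟯ K x p]
    exact mem_adjoin_simple_self _ _
  have hFt (y : K) (hy : y ∈ F) : y ∈ F⟮t⟯ := F⟮t⟯.algebraMap_mem ⟨y, hy⟩
  have hle : (k⟮t⟯⟮x ^ p⟯).toSubfield ≤ (F⟮t⟯).toSubfield := by
    refine Subfield.closure_le.2 (Set.union_subset ?_ ?_)
    · rintro _ ⟨⟨y, hy⟩, rfl⟩
      have : (k⟮t⟯).toSubfield ≤ (F⟮t⟯).toSubfield := by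
        refine Subfield.closure_le.2 (Set.union_subset ?_ ?_)
        · rintro _ ⟨a, rfl⟩
          obtain ⟨b, rfl⟩ := surjective_frobenius k p a
          rw [frobenius_def, map_pow]
          exact hFt _ (hF _)
        · rintro _ rfl
          exact mem_adjoin_simple_self _ _
      exact this hy
    · rintro _ rfl
      exact hFt _ (hF _)
  have hx' : x ∈ F⟮t⟯.toSubalgebra := hle hx
  let q : F[X] := X ^ p - C ⟨t ^ p, hF t⟩
  have hq : q.Monic := monic_X_pow_sub_C _ hp.out.ne_zero
  have hqt : aeval t q = 0 := by
    simp only [q, map_sub, map_pow, aeval_X, aeval_C]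
    exact sub_self _
  rw [adjoin_simple_toSubalgebra_of_isAlgebraic ⟨q, hq.ne_zero, hqt⟩,
    Algebra.adjoin_singleton_eq_range_aeval] at hx'
  obtain ⟨f, rfl⟩ := hx'
  choose c hc using fun i => ((f %ₘ q).coeff i).2
  refine ⟨fun i => c i, ?_⟩
  have hlt : (f %ₘ q).natDegree < p := by
    have h1 : q ≠ 1 := fun h => by simp [h] at hqt
    simpa [q] using natDegree_modByMonic_lt f hq h1
  change aeval t f = _
  rw [← aeval_modByMonic_eq_self_of_root hqt, aeval_eq_sum_range' hlt, Finset.sum_range]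
  refine Finset.sum_congr rfl fun i _ => ?_
  rw [Algebra.smul_def]
  congr 1
  exact (hc i).symm

end

theorem IsSeparating.pow_ne_cmplEmb {k K : Type} [Field k] [Finite k] [Field K] [Algebra k K]
    {p : ℕ} [hp : Fact p.Prime] [CharP k p] {t : K}
    (ht : IsSeparating k t) (v : ValuationSubring K) [IsDiscreteValuationRing v] (y : Cmpl K v) :
    y ^ p ≠ cmplEmb K v t := by
  intro hy
  have : CharP K p := charP_of_injective_algebraMap (algebraMap k K).injective p
  have : CharP (Cmpl K v) p := charP_of_injective_ringHom (cmplEmb K v).injective p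
  obtain ⟨V, -, hV, hval, -⟩ := exists_cmpl_valuation K v
  obtain ⟨π, hπ0, hπ, -⟩ := v.exists_uniformizer
  obtain ⟨c, hc⟩ := ht.exists_eq_sum (p := p) π
  obtain ⟨w, hw⟩ : ∃ w, w ^ p = cmplEmb K v π := by
    refine ⟨∑ i, cmplEmb K v (c i) * y ^ (i : ℕ), ?_⟩
    rw [hc, sum_pow_char, map_sum]
    refine Finset.sum_congr rfl fun i _ => ?_
    rw [mul_pow, map_mul, map_pow, map_pow, ← hy, ← pow_mul, ← pow_mul, mul_comm p]
  obtain ⟨z, hz⟩ := hval w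
  have h1 : v.valuation π < 1 := (hπ π).2 le_rfl
  have h2 : v.valuation z ^ p = v.valuation π := by rw [← hz, ← map_pow, hw, hV]
  have h3 : v.valuation z < 1 := by
    rw [← pow_lt_one_iff hp.out.ne_zero, h2]
    exact h1
  have h4 : v.valuation π < v.valuation π := calc
    v.valuation π = v.valuation z ^ p := h2.symm
    _ ≤ v.valuation π ^ p := pow_le_pow_left₀ zero_le ((hπ z).1 h3) p
    _ < v.valuation π ^ 1 :=
      pow_lt_pow_right_of_lt_one₀ (by simp [zero_lt_iff, hπ0]) h1 hp.out.one_lt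
    _ = v.valuation π := pow_one _
  exact h4.false

section

variable {k K : Type} [Field k] [Field K] [Algebra k K]

/-- The valued field `(L, OL)` with constants `j` satisfies the theory of almost all completions
of the function field `K/k`. -/
def IsAlmostAllModel (k : Type) {K : Type} [Field k] [Field K] [Algebra k K] {L : Type} [Field L]
    (OL : ValuationSubring L) (j : K → L) : Prop :=
  ∀ φ : (Lval[[K]]).Sentence, {v : Places k K | ¬ SatCmplC v φ}.Finite → SatVC K j OL φ

namespace IsAlmostAllModel

open PreVF

variable {L : Type} [Field L] {OL : ValuationSubring L} {j : K → L}

theorem transfer (h : IsAlmostAllModel k OL j) {P : PreVF K → Prop} (hP : IsSen P)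
    (hfin : {v : Places k K | ¬ P (ofVal (cmplO K v.1) (cmplEmb K v.1))}.Finite) :
    P (ofVal OL j) := by
  obtain ⟨φ, hφ⟩ := hP
  refine (hφ _).1 (h φ ?_)
  simpa only [SatCmplC, satVC_iff, hφ] using hfin

theorem transfer_forall (h : IsAlmostAllModel k OL j) {P : PreVF K → Prop} (hP : IsSen P)
    (hall : ∀ v : Places k K, P (ofVal (cmplO K v.1) (cmplEmb K v.1))) : P (ofVal OL j) :=
  h.transfer hP (by simp [hall])

theorem ne_top (h : IsAlmostAllModel k OL j) : OL ≠ ⊤ := by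
  obtain ⟨x, hx⟩ := h.transfer_forall isSen_exists_notMem fun v => by
    by_contra! H
    exact cmplO_ne_top v.2.1 (top_unique fun x _ => H x)
  rintro rfl
  exact hx trivial

theorem exists_ringHom (h : IsAlmostAllModel k OL j) : ∃ f : K →+* L, ⇑f = j := by
  have hadd (a b : K) : j (a + b) = j a + j b :=
    h.transfer_forall (isSen_ι_add a b) fun v => map_add (cmplEmb K v.1) a b
  have hmul (a b : K) : j (a * b) = j a * j b :=
    h.transfer_forall (isSen_ι_mul a b) fun v => map_mul (cmplEmb K v.1) a b
  have hone : j 1 = 1 := h.transfer_forall isSen_ι_one fun v => map_one (cmplEmb K v.1)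
  exact ⟨RingHom.mk' ⟨⟨j, hone⟩, hmul⟩ hadd, rfl⟩

theorem exists_not_satVC {φ : (Lval[[K]]).Sentence}
    (h : {v : Places k K | ¬ SatCmplC v φ}.Infinite) :
    ∃ (L : Type) (_ : Field L) (OL : ValuationSubring L) (j : K → L),
      IsAlmostAllModel k OL j ∧ ¬ SatVC K j OL φ := by
  have := h.cofinite_inf_principal_neBot
  let u := Ultrafilter.of (Filter.cofinite ⊓ Filter.principal {v : Places k K | ¬ SatCmplC v φ})
  have hu := Ultrafilter.of_le
    (Filter.cofinite ⊓ Filter.principal {v : Places k K | ¬ SatCmplC v φ})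
  obtain ⟨L, _, OL, j, hL⟩ := PreVF.exists_ultraproduct u (fun v : Places k K => cmplO K v.1)
    fun v => cmplEmb K v.1
  refine ⟨L, _, OL, j, fun ψ hψ => (hL ψ).2 ?_, fun H => ?_⟩
  · exact hu (Filter.mem_inf_of_left (Filter.eventually_cofinite.2 hψ))
  · have h1 := (hL φ).1 H
    have h2 : ∀ᶠ v in (u : Filter (Places k K)), ¬ SatCmplC v φ :=
      hu (Filter.mem_inf_of_right (Filter.mem_principal_self _))
    obtain ⟨v, h3, h4⟩ := (h1.and h2).exists
    exact h4 h3

variable [Finite k]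

theorem henselianLocalRing (hK : IsFunctionField k K) (h : IsAlmostAllModel k OL j) :
    HenselianLocalRing OL := by
  refine (hensel_iff OL j).1 fun n => h.transfer_forall (isSen_hensel n) fun v => ?_
  have := (hK.place v).1
  exact (hensel_iff _ _).2 henselianLocalRing_cmplO n

theorem mem (hK : IsFunctionField k K) (h : IsAlmostAllModel k OL j) (x : K) : j x ∈ OL :=
  h.transfer (isSen_ι_mem x) ((hK.finite_notMem x).subset fun _ hv H => hv (cmplEmb_mem.2 H))

theorem separableExt (hK : IsFunctionField k K) {j : K →+* L} (h : IsAlmostAllModel k OL j) :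
    SeparableExt j := by
  intro E _ i
  let := j.toAlgebra
  let := i.toAlgebra
  obtain ⟨p, _⟩ := CharP.exists k
  have hp : Fact p.Prime := ⟨CharP.char_is_prime k p⟩
  have : CharP K p := charP_of_injective_algebraMap (algebraMap k K).injective p
  obtain ⟨t, ht⟩ := hK.exists_isSeparating
  refine isReduced_tensorProduct_of_pow_ne (p := p) ht.exists_eq_sum
    (h.transfer_forall (isSen_forall_pow_ne t p) fun v => ?_)
  have := (hK.place v).1
  exact ht.pow_ne_cmplEmb v.1

theorem isPseudofinite (hK : IsFunctionField k K) {j : K →+* L} (h : IsAlmostAllModel k OL j) :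
    IsPseudofinite (ResF OL) := by
  refine ⟨?_, fun φ hφ => ?_⟩
  · have : Infinite K := by
      by_contra hfin
      rw [not_infinite_iff_finite] at hfin
      obtain ⟨t, ht⟩ := hK.exists_isSeparating
      exact ht.transcendental (Algebra.IsAlgebraic.isAlgebraic t)
    exact Infinite.of_injective _ (resRingHom OL j (h.mem hK)).injective
  · obtain ⟨ψ, hψ⟩ := exists_residue_sentence K φ
    refine (hψ OL j).1 (h.transfer_forall ⟨ψ, fun _ => Iff.rfl⟩ fun v => (hψ _ _).2 ?_)
    obtain ⟨_, _⟩ := hK.place v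
    exact hφ _ _ finite_resF_cmplO

end IsAlmostAllModel

end

/-- Lemma 5.2: every model of the `𝔏_val(K)`-theory of almost all
completions `K̂_v` of a global function field `K` is a henselian nontrivially valued field,
separable over the trivially valued field `K`, with pseudofinite residue field; in
particular that theory contains the theory of the class of all such valued fields. -/
theorem models_of_theory_almost_all_completions (k K : Type) [Field k] [Finite k] [Field K]
    [Algebra k K] (hK : IsFunctionField k K) :
    (∀ (L : Type) [Field L] (OL : ValuationSubring L) (j : K → L),
      (∀ φ : (Lval[[K]]).Sentence,
          {v : Places k K | ¬ SatCmplC v φ}.Finite → SatVC K j OL φ) →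
      HenselianLocalRing ↥OL ∧ OL ≠ ⊤ ∧
      (∃ jh : K →+* L, ⇑jh = j ∧
        (∀ x : K, jh x ∈ OL ∧ (x ≠ 0 → (jh x)⁻¹ ∈ OL)) ∧ SeparableExt jh) ∧
      IsPseudofinite (ResF OL))
    ∧ ∀ φ : (Lval[[K]]).Sentence,
        (∀ (F : Type) [Field F] (OF : ValuationSubring F) (jh : K →+* F),
          HenselianLocalRing ↥OF → OF ≠ ⊤ → (∀ x : K, jh x ∈ OF) → SeparableExt jh →
          IsPseudofinite (ResF OF) → SatVC K (⇑jh) OF φ) →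
        {v : Places k K | ¬ SatCmplC v φ}.Finite := by
  constructor
  · intro L _ OL j h
    replace h : IsAlmostAllModel k OL j := h
    obtain ⟨f, rfl⟩ := h.exists_ringHom
    refine ⟨h.henselianLocalRing hK, h.ne_top, ⟨f, rfl, fun x => ⟨h.mem hK x, fun _ => ?_⟩,
      h.separableExt hK⟩, h.isPseudofinite hK⟩
    rw [← map_inv₀]
    exact h.mem hK x⁻¹
  · intro φ hφ
    by_contra hinf
    obtain ⟨L, _, OL, j, h, hn⟩ := IsAlmostAllModel.exists_not_satVC hinf
    obtain ⟨f, rfl⟩ := h.exists_ringHom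
    exact hn (hφ L OL f (h.henselianLocalRing hK) h.ne_top (h.mem hK) (h.separableExt hK)
      (h.isPseudofinite hK))
end
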